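/- arXiv:1210.7221 — 6 statements merged into one kernel-verified Lean document; each statement's English description precedes it below -/
import Mathlib

section
/- Let α ∈ [0,1] and let f : Δ(K)×Δ(L) → [−1,1] be continuous and such that for every p* ∈ P* and q* ∈ Q*, f is concave in its first variable on B^{-1}(p*) (for each fixed q) and convex in its second variable on C^{-1}(q*) (for each fixed p). Then for all (p,q) ∈ Δ(K)×Δ(L) the game defining Φ_α(f)(p,q) has a value: sup_{x∈NR(p)} inf_{y∈NR(q)} [ α G(p,q,x,y) + (1−α) Σ_{i,j} x(p)(i) y(q)(j) f(p⃗(x,i)M, q⃗(y,j)N) ] = inf_{y∈NR(q)} sup_{x∈NR(p)} [ α G(p,q,x,y) + (1−α) Σ_{i,j} x(p)(i) y(q)(j) f(p⃗(x,i)M, q⃗(y,j)N) ], and the outer sup and inf are attained. -/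
/-- The `L¹` distance between two vectors indexed by a finite set. -/
noncomputable def dist1 {S : Type*} [Fintype S] (p p' : S → ℝ) : ℝ :=
  ∑ k, |p k - p' k|

/-- Row-vector times matrix multiplication, `(p A) k' = ∑ k, p k * A k k'`. -/
noncomputable def vecMulF {K : Type*} [Fintype K] (p : K → ℝ) (A : K → K → ℝ) : K → ℝ :=
  fun k' => ∑ k, p k * A k k'

/-- A recurrence structure on a finite set `K`: a partition of `K` into `R` nonempty
classes (given by the class map `cls`, surjectivity expressing nonemptiness of classes),
together with, for each class `r`, a probability vector `pstar r ∈ Δ(K)` supported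
in the class `r`. -/
structure RecStruct (K : Type*) [Fintype K] (R : ℕ) where
  cls : K → Fin R
  cls_surj : Function.Surjective cls
  pstar : Fin R → K → ℝ
  pstar_mem : ∀ r, pstar r ∈ stdSimplex ℝ K
  pstar_supp : ∀ r k, pstar r k ≠ 0 → cls k = r

namespace RecStruct

variable {K : Type*} [Fintype K] {R : ℕ}

/-- `lam rs p r` is the total mass given by `p` to the recurrence class `r`. -/
noncomputable def lam (rs : RecStruct K R) (p : K → ℝ) : Fin R → ℝ :=
  fun r => ∑ k, if rs.cls k = r then p k else 0

/-- The conditional law of `p` given the recurrence class `r` (equal to `pstar r` when the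
class has zero mass under `p`). -/
noncomputable def cond (rs : RecStruct K R) (p : K → ℝ) (r : Fin R) : K → ℝ :=
  if 0 < rs.lam p r then (fun k => if rs.cls k = r then p k / rs.lam p r else 0)
  else rs.pstar r

/-- The quantity `S(p,p') = ‖λ(p) - λ(p')‖₁ + ∑_{r : λ(p)^r λ(p')^r > 0} λ(p')^r ‖p_{|r} - p'_{|r}‖₁`. -/
noncomputable def Sdist (rs : RecStruct K R) (p p' : K → ℝ) : ℝ :=
  dist1 (rs.lam p) (rs.lam p') +
    ∑ r, if 0 < rs.lam p r * rs.lam p' r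
      then rs.lam p' r * dist1 (rs.cond p r) (rs.cond p' r) else 0

/-- The projection matrix `B`, whose row `k` is `pstar r` where `r` is the class of `k`. -/
noncomputable def Bmat (rs : RecStruct K R) : K → K → ℝ :=
  fun k k' => rs.pstar (rs.cls k) k'

/-- `P*`, the convex hull of the invariant measures of the classes. -/
noncomputable def Pset (rs : RecStruct K R) : Set (K → ℝ) :=
  convexHull ℝ (Set.range rs.pstar)

/-- `B^{-1}(p*) = {p ∈ Δ(K) : pB = p*}`. -/
def Binv (rs : RecStruct K R) (pst : K → ℝ) : Set (K → ℝ) :=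
  {p | p ∈ stdSimplex ℝ K ∧ vecMulF p rs.Bmat = pst}

/-- A stochastic matrix on `K` compatible with the recurrence structure: it is block
diagonal with respect to the partition and each `pstar r` is invariant. -/
structure IsCompatible (rs : RecStruct K R) (M : K → K → ℝ) : Prop where
  nonneg : ∀ k k', 0 ≤ M k k'
  rowSum : ∀ k, ∑ k', M k k' = 1
  block : ∀ k k', rs.cls k ≠ rs.cls k' → M k k' = 0
  invariant : ∀ r, vecMulF (rs.pstar r) M = rs.pstar r

end RecStruct

/-- `xOfp p x i = x(p)(i) = ∑ k, p^k x^k(i)`, the total probability of action `i`. -/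
noncomputable def xOfp {K I : Type*} [Fintype K] (p : K → ℝ) (x : K → I → ℝ) (i : I) : ℝ :=
  ∑ k, p k * x k i

/-- `pvec p x i = p⃗(x,i)`, the conditional law on `K` after action `i` is observed
(junk value when `x(p)(i) = 0`). -/
noncomputable def pvec {K I : Type*} [Fintype K] (p : K → ℝ) (x : K → I → ℝ) (i : I) : K → ℝ :=
  fun k => p k * x k i / xOfp p x i

/-- The set `NR(p)` of nonrevealing one-stage strategies at `p`:
profiles `x ∈ Δ(I)^K` such that `(p^k x^k(i))_k · B = x(p)(i) · (pB)` for every action `i`. -/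
def NR {K I : Type*} [Fintype K] [Fintype I] {R : ℕ}
    (rs : RecStruct K R) (p : K → ℝ) : Set (K → I → ℝ) :=
  {x | (∀ k, x k ∈ stdSimplex ℝ I) ∧
    ∀ i, vecMulF (fun k => p k * x k i) rs.Bmat = xOfp p x i • vecMulF p rs.Bmat}

/-- The expected one-stage payoff `G(p,q,x,y)`. -/
noncomputable def Gpay {K L I J : Type*} [Fintype K] [Fintype L] [Fintype I] [Fintype J]
    (g : K → L → I → J → ℝ) (p : K → ℝ) (q : L → ℝ) (x : K → I → ℝ) (y : L → J → ℝ) : ℝ :=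
  ∑ k, ∑ l, ∑ i, ∑ j, p k * q l * x k i * y l j * g k l i j

/-- The payoff of the one-shot game defining the operator `Φ_α`:
`α G(p,q,x,y) + (1-α) ∑_{i,j} x(p)(i) y(q)(j) f(p⃗(x,i)M, q⃗(y,j)N)`
(summands with zero coefficient vanish). -/
noncomputable def payoff {K L I J : Type*} [Fintype K] [Fintype L] [Fintype I] [Fintype J]
    (M : K → K → ℝ) (N : L → L → ℝ) (g : K → L → I → J → ℝ) (α : ℝ)
    (f : (K → ℝ) → (L → ℝ) → ℝ) (p : K → ℝ) (q : L → ℝ)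
    (x : K → I → ℝ) (y : L → J → ℝ) : ℝ :=
  α * Gpay g p q x y + (1 - α) * ∑ i, ∑ j,
    xOfp p x i * xOfp q y j * f (vecMulF (pvec p x i) M) (vecMulF (pvec q y j) N)

/-- The operator `Φ_α(f)(p,q) = sup_{x ∈ NR(p)} inf_{y ∈ NR(q)} [payoff]`. -/
noncomputable def Phi {K L I J : Type*} [Fintype K] [Fintype L] [Fintype I] [Fintype J]
    {RK RL : ℕ} (rsK : RecStruct K RK) (rsL : RecStruct L RL)
    (M : K → K → ℝ) (N : L → L → ℝ) (g : K → L → I → J → ℝ) (α : ℝ)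
    (f : (K → ℝ) → (L → ℝ) → ℝ) (p : K → ℝ) (q : L → ℝ) : ℝ :=
  sSup {v : ℝ | ∃ x ∈ (NR rsK p : Set (K → I → ℝ)),
    v = sInf {u : ℝ | ∃ y ∈ (NR rsL q : Set (L → J → ℝ)),
      u = payoff M N g α f p q x y}}

/-- The class `F` of functions `f : Δ(K)×Δ(L) → [-1,1]` such that
(i) `f(p,q) - f(p',q) ≤ S_K(p,p')`, (ii) `f(p,q) - f(p,q') ≤ S_L(q',q)`, and
(iii) for all `p* ∈ P*`, `q* ∈ Q*`, `f` is concave in `p` on `B^{-1}(p*)` and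
convex in `q` on `C^{-1}(q*)`. -/
structure MemF {K L : Type*} [Fintype K] [Fintype L] {RK RL : ℕ}
    (rsK : RecStruct K RK) (rsL : RecStruct L RL)
    (f : (K → ℝ) → (L → ℝ) → ℝ) : Prop where
  mem_Icc : ∀ p ∈ stdSimplex ℝ K, ∀ q ∈ stdSimplex ℝ L, f p q ∈ Set.Icc (-1 : ℝ) 1
  lipK : ∀ p ∈ stdSimplex ℝ K, ∀ p' ∈ stdSimplex ℝ K, ∀ q ∈ stdSimplex ℝ L,
    f p q - f p' q ≤ rsK.Sdist p p'
  lipL : ∀ p ∈ stdSimplex ℝ K, ∀ q ∈ stdSimplex ℝ L, ∀ q' ∈ stdSimplex ℝ L,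
    f p q - f p q' ≤ rsL.Sdist q' q
  concaveI : ∀ pst ∈ rsK.Pset, ∀ q ∈ stdSimplex ℝ L,
    ConcaveOn ℝ (rsK.Binv pst) (fun p => f p q)
  convexII : ∀ qst ∈ rsL.Pset, ∀ p ∈ stdSimplex ℝ K,
    ConvexOn ℝ (rsL.Binv qst) (fun q => f p q)

section Saddle

variable {A B : Type*} {X : Set A} {Y : Set B} {F : A → B → ℝ}

/-- If `(a, b)` is a saddle point, `F a b` is the value of the game, and `a`, `b` are optimal. -/
theorem value_of_saddlePoint {a : A} {b : B} (ha : a ∈ X) (hb : b ∈ Y)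
    (h : ∀ x ∈ X, ∀ y ∈ Y, F x b ≤ F a y)
    (hbelow : ∀ x ∈ X, BddBelow (F x '' Y)) (habove : ∀ y ∈ Y, BddAbove ((F · y) '' X)) :
    (sSup {v : ℝ | ∃ x ∈ X, v = sInf {u : ℝ | ∃ y ∈ Y, u = F x y}}
      = sInf {v : ℝ | ∃ y ∈ Y, v = sSup {u : ℝ | ∃ x ∈ X, u = F x y}}) ∧
    (∃ x₀ ∈ X, sInf {u : ℝ | ∃ y ∈ Y, u = F x₀ y}
      = sSup {v : ℝ | ∃ x ∈ X, v = sInf {u : ℝ | ∃ y ∈ Y, u = F x y}}) ∧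
    (∃ y₀ ∈ Y, sSup {u : ℝ | ∃ x ∈ X, u = F x y₀}
      = sInf {v : ℝ | ∃ y ∈ Y, v = sSup {u : ℝ | ∃ x ∈ X, u = F x y}}) := by
  have hinf : sInf {u : ℝ | ∃ y ∈ Y, u = F a y} = F a b := by
    refine IsLeast.csInf_eq ⟨⟨b, hb, rfl⟩, ?_⟩
    rintro _ ⟨y, hy, rfl⟩
    exact h a ha y hy
  have hsup : sSup {u : ℝ | ∃ x ∈ X, u = F x b} = F a b := by
    refine IsGreatest.csSup_eq ⟨⟨a, ha, rfl⟩, ?_⟩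
    rintro _ ⟨x, hx, rfl⟩
    exact h x hx b hb
  have hsupinf : sSup {v : ℝ | ∃ x ∈ X, v = sInf {u : ℝ | ∃ y ∈ Y, u = F x y}} = F a b := by
    refine IsGreatest.csSup_eq ⟨⟨a, ha, hinf.symm⟩, ?_⟩
    rintro _ ⟨x, hx, rfl⟩
    refine le_trans (csInf_le ?_ ⟨b, hb, rfl⟩) (h x hx b hb)
    simpa only [Set.image, eq_comm] using hbelow x hx
  have hinfsup : sInf {v : ℝ | ∃ y ∈ Y, v = sSup {u : ℝ | ∃ x ∈ X, u = F x y}} = F a b := by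
    refine IsLeast.csInf_eq ⟨⟨b, hb, hsup.symm⟩, ?_⟩
    rintro _ ⟨y, hy, rfl⟩
    refine le_trans (h a ha y hy) (le_csSup ?_ ⟨a, ha, rfl⟩)
    simpa only [Set.image, eq_comm] using habove y hy
  exact ⟨hsupinf.trans hinfsup.symm, ⟨a, ha, hinf.trans hsupinf.symm⟩,
    ⟨b, hb, hsup.trans hinfsup.symm⟩⟩

end Saddle

theorem joint_combo {K I : Type*} (p : K → ℝ) (x x' : K → I → ℝ) (a b : ℝ) (i : I) :
    (fun k => p k * (a • x + b • x') k i)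
      = a • (fun k => p k * x k i) + b • (fun k => p k * x' k i) := by
  ext k
  simp only [Pi.add_apply, Pi.smul_apply, smul_eq_mul]
  ring

section OneSide

variable {K I : Type*} [Fintype K] {R : ℕ}

theorem vecMulF_add (u v : K → ℝ) (A : K → K → ℝ) :
    vecMulF (u + v) A = vecMulF u A + vecMulF v A := by
  ext k
  simp [vecMulF, add_mul, Finset.sum_add_distrib]

theorem vecMulF_smul (c : ℝ) (u : K → ℝ) (A : K → K → ℝ) :
    vecMulF (c • u) A = c • vecMulF u A := by
  ext k
  simp [vecMulF, mul_assoc, Finset.mul_sum]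

theorem continuous_vecMulF (A : K → K → ℝ) : Continuous fun u => vecMulF u A := by
  unfold vecMulF
  fun_prop

namespace RecStruct.IsCompatible

variable {rs : RecStruct K R} {M : K → K → ℝ}

theorem vecMulF_mem_stdSimplex (hM : rs.IsCompatible M) {u : K → ℝ} (hu : u ∈ stdSimplex ℝ K) :
    vecMulF u M ∈ stdSimplex ℝ K := by
  refine ⟨fun k => Finset.sum_nonneg fun j _ => mul_nonneg (hu.1 j) (hM.nonneg j k), ?_⟩
  simp only [vecMulF]
  rw [Finset.sum_comm]
  simp only [← Finset.mul_sum, hM.rowSum, mul_one]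
  exact hu.2

theorem vecMulF_vecMulF_Bmat (hM : rs.IsCompatible M) (u : K → ℝ) :
    vecMulF (vecMulF u M) rs.Bmat = vecMulF u rs.Bmat := by
  ext k'
  simp only [vecMulF, Finset.sum_mul]
  rw [Finset.sum_comm]
  refine Finset.sum_congr rfl fun k _ => ?_
  have hrow : ∀ j, M k j * rs.Bmat j k' = M k j * rs.Bmat k k' := by
    intro j
    by_cases hj : rs.cls k = rs.cls j
    · simp [Bmat, hj]
    · simp [hM.block k j hj]
  simp only [mul_assoc, hrow]
  rw [← Finset.mul_sum, ← Finset.sum_mul, hM.rowSum, one_mul]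

end RecStruct.IsCompatible

theorem RecStruct.vecMulF_Bmat_mem_Pset (rs : RecStruct K R) {p : K → ℝ}
    (hp : p ∈ stdSimplex ℝ K) : vecMulF p rs.Bmat ∈ rs.Pset := by
  have h : vecMulF p rs.Bmat = ∑ k, p k • rs.pstar (rs.cls k) := by
    ext k'
    simp [vecMulF, Bmat]
  rw [h]
  exact (convex_convexHull ℝ _).sum_mem (fun k _ => hp.1 k) hp.2
    fun k _ => subset_convexHull ℝ _ ⟨_, rfl⟩

theorem xOfp_combo (p : K → ℝ) (x x' : K → I → ℝ) (a b : ℝ) (i : I) :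
    xOfp p (a • x + b • x') i = a * xOfp p x i + b * xOfp p x' i := by
  simp only [xOfp, Finset.mul_sum, ← Finset.sum_add_distrib]
  refine Finset.sum_congr rfl fun k _ => ?_
  simp only [Pi.add_apply, Pi.smul_apply, smul_eq_mul]
  ring

theorem continuous_xOfp (p : K → ℝ) (i : I) : Continuous fun x : K → I → ℝ => xOfp p x i := by
  unfold xOfp
  fun_prop

/-- The law of the next state once action `i` is observed, with the default value `p` when the
action has probability zero. -/
noncomputable def nextLaw (M : K → K → ℝ) (p : K → ℝ) (x : K → I → ℝ) (i : I) : K → ℝ :=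
  if xOfp p x i = 0 then p else vecMulF (pvec p x i) M

variable [Fintype I] {rs : RecStruct K R} {M : K → K → ℝ} {p : K → ℝ}

theorem xOfp_nonneg (hp : p ∈ stdSimplex ℝ K) {x : K → I → ℝ} (hx : x ∈ NR rs p) (i : I) :
    0 ≤ xOfp p x i :=
  Finset.sum_nonneg fun k _ => mul_nonneg (hp.1 k) ((hx.1 k).1 i)

theorem nextLaw_mem_Binv (hM : rs.IsCompatible M) (hp : p ∈ stdSimplex ℝ K) {x : K → I → ℝ}
    (hx : x ∈ NR rs p) (i : I) : nextLaw M p x i ∈ rs.Binv (vecMulF p rs.Bmat) := by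
  unfold nextLaw
  split_ifs with h
  · exact ⟨hp, rfl⟩
  · have hpvec : pvec p x i = (xOfp p x i)⁻¹ • fun k => p k * x k i := by
      ext k
      simp [pvec, div_eq_inv_mul]
    refine ⟨hM.vecMulF_mem_stdSimplex ⟨fun k => ?_, ?_⟩, ?_⟩
    · exact div_nonneg (mul_nonneg (hp.1 k) ((hx.1 k).1 i)) (xOfp_nonneg hp hx i)
    · simp only [pvec, ← Finset.sum_div]
      exact div_self h
    · rw [hM.vecMulF_vecMulF_Bmat, hpvec, vecMulF_smul, hx.2 i, inv_smul_smul₀ h]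

theorem xOfp_smul_nextLaw (hp : p ∈ stdSimplex ℝ K) {x : K → I → ℝ} (hx : x ∈ NR rs p) (i : I) :
    xOfp p x i • nextLaw M p x i = vecMulF (fun k => p k * x k i) M := by
  unfold nextLaw
  split_ifs with h
  · have h0 : (fun k => p k * x k i) = 0 := by
      ext k
      exact (Finset.sum_eq_zero_iff_of_nonneg
        fun k _ => mul_nonneg (hp.1 k) ((hx.1 k).1 i)).1 h k (Finset.mem_univ k)
    rw [h, h0]
    ext k
    simp [vecMulF]
  · rw [← vecMulF_smul]
    congr 1
    ext k
    simp only [pvec, Pi.smul_apply, smul_eq_mul]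
    field_simp

theorem convex_NR : Convex ℝ (NR rs p : Set (K → I → ℝ)) := by
  intro x hx x' hx' a b ha hb hab
  refine ⟨fun k => convex_stdSimplex ℝ I (hx.1 k) (hx'.1 k) ha hb hab, fun i => ?_⟩
  rw [joint_combo, vecMulF_add, vecMulF_smul, vecMulF_smul, hx.2 i, hx'.2 i, xOfp_combo]
  module

theorem isCompact_NR : IsCompact (NR rs p : Set (K → I → ℝ)) := by
  have h : (NR rs p : Set (K → I → ℝ)) = (Set.univ.pi fun _ : K => stdSimplex ℝ I) ∩
      {x | ∀ i, vecMulF (fun k => p k * x k i) rs.Bmat = xOfp p x i • vecMulF p rs.Bmat} := by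
    ext x
    simp [NR, Set.mem_pi]
  rw [h]
  refine (isCompact_univ_pi fun _ => isCompact_stdSimplex ℝ I).inter_right ?_
  simp only [Set.ofPred_forall]
  refine isClosed_iInter fun i => isClosed_eq ?_ ?_
  · exact (continuous_vecMulF _).comp (by fun_prop)
  · exact (continuous_xOfp p i).smul continuous_const

theorem nonempty_NR [Nonempty I] (hp : p ∈ stdSimplex ℝ K) :
    (NR rs p : Set (K → I → ℝ)).Nonempty := by
  classical
  obtain ⟨i₀⟩ := ‹Nonempty I›
  refine ⟨fun _ => Pi.single i₀ 1, fun _ => single_mem_stdSimplex ℝ i₀, fun i => ?_⟩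
  have h1 : (fun k => p k * (Pi.single i₀ 1 : I → ℝ) i) = (Pi.single i₀ 1 : I → ℝ) i • p := by
    ext k
    simp [mul_comm]
  have h2 : xOfp p (fun _ => Pi.single i₀ 1) i = (Pi.single i₀ 1 : I → ℝ) i := by
    simp only [xOfp, ← Finset.sum_mul]
    rw [hp.2, one_mul]
  rw [h1, h2, vecMulF_smul]

variable {φ : (K → ℝ) → ℝ}

theorem concaveOn_xOfp_mul_nextLaw (hM : rs.IsCompatible M) (hp : p ∈ stdSimplex ℝ K)
    (hφ : ConcaveOn ℝ (rs.Binv (vecMulF p rs.Bmat)) φ) (i : I) :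
    ConcaveOn ℝ (NR rs p : Set (K → I → ℝ)) fun x => xOfp p x i * φ (nextLaw M p x i) := by
  refine ⟨convex_NR, fun x hx x' hx' a b ha hb hab => ?_⟩
  have hz := convex_NR hx hx' ha hb hab
  have hs := xOfp_combo p x x' a b i
  have hsmul := xOfp_smul_nextLaw (M := M) hp hz i
  rw [joint_combo, vecMulF_add, vecMulF_smul, vecMulF_smul, ← xOfp_smul_nextLaw hp hx,
    ← xOfp_smul_nextLaw hp hx'] at hsmul
  have h1 := mul_nonneg ha (xOfp_nonneg hp hx i)
  have h2 := mul_nonneg hb (xOfp_nonneg hp hx' i)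
  simp only [smul_eq_mul, ← mul_assoc]
  set s := xOfp p (a • x + b • x') i
  rcases (xOfp_nonneg hp hz i).eq_or_lt with h0 | hpos
  · have e1 : a * xOfp p x i = 0 := by linarith
    have e2 : b * xOfp p x' i = 0 := by linarith
    change 0 = s at h0
    simp [e1, e2, ← h0]
  · change 0 < s at hpos
    have hnext : nextLaw M p (a • x + b • x') i = (a * xOfp p x i / s) • nextLaw M p x i
        + (b * xOfp p x' i / s) • nextLaw M p x' i := by
      rw [← inv_smul_smul₀ hpos.ne' (nextLaw M p (a • x + b • x') i), hsmul]
      module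
    have hc := hφ.2 (nextLaw_mem_Binv hM hp hx i) (nextLaw_mem_Binv hM hp hx' i)
      (div_nonneg h1 hpos.le) (div_nonneg h2 hpos.le)
      (by rw [← add_div, ← hs, div_self hpos.ne'])
    rw [← hnext, smul_eq_mul, smul_eq_mul] at hc
    have hc' := mul_le_mul_of_nonneg_left hc hpos.le
    refine le_trans (le_of_eq ?_) hc'
    field_simp

theorem continuousOn_xOfp_mul_nextLaw (hM : rs.IsCompatible M) (hp : p ∈ stdSimplex ℝ K)
    (hφ : ContinuousOn φ (stdSimplex ℝ K)) (i : I) :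
    ContinuousOn (fun x => xOfp p x i * φ (nextLaw M p x i)) (NR rs p : Set (K → I → ℝ)) := by
  have hcont := continuous_xOfp p i
  have hmem : ∀ x ∈ (NR rs p : Set (K → I → ℝ)), nextLaw M p x i ∈ stdSimplex ℝ K :=
    fun x hx => (nextLaw_mem_Binv hM hp hx i).1
  intro x₀ hx₀
  by_cases h : xOfp p x₀ i = 0
  · obtain ⟨C, hC⟩ := (isCompact_stdSimplex ℝ K).exists_bound_of_continuousOn hφ
    have hlim : Filter.Tendsto (fun x => |xOfp p x i| * C) (nhdsWithin x₀ (NR rs p)) (nhds 0) := by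
      have hC : Continuous fun x : K → I → ℝ => |xOfp p x i| * C := by fun_prop
      simpa only [h, abs_zero, zero_mul] using hC.continuousWithinAt.tendsto (x := x₀)
    simp only [ContinuousWithinAt, h, zero_mul]
    refine squeeze_zero_norm' ?_ hlim
    filter_upwards [self_mem_nhdsWithin] with x hx
    rw [norm_mul]
    exact mul_le_mul_of_nonneg_left (hC _ (hmem x hx)) (norm_nonneg _)
  · have hpvec : ContinuousAt (fun x : K → I → ℝ => vecMulF (pvec p x i) M) x₀ := by
      refine (continuous_vecMulF M).continuousAt.comp (continuousAt_pi.2 fun k => ?_)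
      have hnum : Continuous fun x : K → I → ℝ => p k * x k i := by fun_prop
      exact hnum.continuousAt.div hcont.continuousAt h
    have hnext : ContinuousAt (fun x : K → I → ℝ => nextLaw M p x i) x₀ := by
      refine hpvec.congr ?_
      filter_upwards [hcont.continuousAt.eventually_ne h] with x hx
      simp [nextLaw, hx]
    exact hcont.continuousWithinAt.mul
      ((hφ _ (hmem x₀ hx₀)).comp (f := fun x => nextLaw M p x i) hnext.continuousWithinAt hmem)

end OneSide

section Payoff

variable {K L I J : Type*} [Fintype K] [Fintype L] [Fintype I] [Fintype J] {RK RL : ℕ}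
  {rsK : RecStruct K RK} {rsL : RecStruct L RL} {M : K → K → ℝ} {N : L → L → ℝ}
  {g : K → L → I → J → ℝ} {α : ℝ} {f : (K → ℝ) → (L → ℝ) → ℝ} {p : K → ℝ} {q : L → ℝ}

theorem payoff_eq_nextLaw (x : K → I → ℝ) (y : L → J → ℝ) :
    payoff M N g α f p q x y = α * Gpay g p q x y + (1 - α) * ∑ i, ∑ j,
      xOfp q y j * (xOfp p x i * f (nextLaw M p x i) (nextLaw N q y j)) := by
  unfold payoff
  congr 2
  refine Finset.sum_congr rfl fun i _ => Finset.sum_congr rfl fun j _ => ?_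
  by_cases hi : xOfp p x i = 0
  · simp [hi]
  by_cases hj : xOfp q y j = 0
  · simp [hj]
  simp only [nextLaw, hi, hj, if_false]
  ring

/-- Exchanging the roles of the two players changes the sign of the payoff. -/
theorem payoff_swap (x : K → I → ℝ) (y : L → J → ℝ) :
    payoff N M (fun l k j i => -g k l i j) α (fun q p => -f p q) q p y x
      = -payoff M N g α f p q x y := by
  have hG : Gpay (fun l k j i => -g k l i j) q p y x = -Gpay g p q x y := by
    simp only [Gpay, ← Finset.sum_neg_distrib]
    rw [Finset.sum_comm]
    refine Finset.sum_congr rfl fun k _ => Finset.sum_congr rfl fun l _ => ?_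
    rw [Finset.sum_comm]
    refine Finset.sum_congr rfl fun i _ => Finset.sum_congr rfl fun j _ => ?_
    ring
  unfold payoff
  rw [hG, Finset.sum_comm, neg_add, ← mul_neg, ← mul_neg]
  simp only [← Finset.sum_neg_distrib]
  congr 2
  refine Finset.sum_congr rfl fun i _ => Finset.sum_congr rfl fun j _ => ?_
  ring

theorem Gpay_combo (x x' : K → I → ℝ) (y : L → J → ℝ) (a b : ℝ) :
    Gpay g p q (a • x + b • x') y = a * Gpay g p q x y + b * Gpay g p q x' y := by
  simp only [Gpay, Finset.mul_sum, ← Finset.sum_add_distrib]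
  refine Finset.sum_congr rfl fun k _ => Finset.sum_congr rfl fun l _ =>
    Finset.sum_congr rfl fun i _ => Finset.sum_congr rfl fun j _ => ?_
  simp only [Pi.add_apply, Pi.smul_apply, smul_eq_mul]
  ring

theorem concaveOn_payoff (hM : rsK.IsCompatible M) (hN : rsL.IsCompatible N)
    (hα : α ∈ Set.Icc (0 : ℝ) 1)
    (hf : ∀ pst ∈ rsK.Pset, ∀ q ∈ stdSimplex ℝ L, ConcaveOn ℝ (rsK.Binv pst) fun p => f p q)
    (hp : p ∈ stdSimplex ℝ K) (hq : q ∈ stdSimplex ℝ L) {y : L → J → ℝ} (hy : y ∈ NR rsL q) :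
    ConcaveOn ℝ (NR rsK p : Set (K → I → ℝ)) fun x => payoff M N g α f p q x y := by
  have hterm : ∀ i j, ConcaveOn ℝ (NR rsK p : Set (K → I → ℝ)) fun x =>
      xOfp q y j * (xOfp p x i * f (nextLaw M p x i) (nextLaw N q y j)) := fun i j =>
    (concaveOn_xOfp_mul_nextLaw (φ := fun p => f p (nextLaw N q y j)) hM hp
      (hf _ (rsK.vecMulF_Bmat_mem_Pset hp) _ (nextLaw_mem_Binv hN hq hy j).1) i).smul
      (xOfp_nonneg hq hy j)
  refine ⟨convex_NR, fun x hx x' hx' a b ha hb hab => ?_⟩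
  have hsum : ∑ i, ∑ j, _ ≤ ∑ i, ∑ j, _ := Finset.sum_le_sum fun i _ =>
    Finset.sum_le_sum fun j _ => (hterm i j).2 hx hx' ha hb hab
  simp only [smul_eq_mul, Finset.sum_add_distrib, ← Finset.mul_sum] at hsum
  simp only [smul_eq_mul, payoff_eq_nextLaw, Gpay_combo]
  have := mul_le_mul_of_nonneg_left hsum (sub_nonneg.2 hα.2)
  linarith

theorem continuousOn_payoff (hM : rsK.IsCompatible M) (hN : rsL.IsCompatible N)
    (hf : ContinuousOn (fun pq : (K → ℝ) × (L → ℝ) => f pq.1 pq.2)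
      (stdSimplex ℝ K ×ˢ stdSimplex ℝ L))
    (hp : p ∈ stdSimplex ℝ K) (hq : q ∈ stdSimplex ℝ L) {y : L → J → ℝ} (hy : y ∈ NR rsL q) :
    ContinuousOn (fun x => payoff M N g α f p q x y) (NR rsK p : Set (K → I → ℝ)) := by
  simp only [payoff_eq_nextLaw]
  have hG : Continuous fun x : K → I → ℝ => Gpay g p q x y := by
    unfold Gpay
    fun_prop
  refine (continuous_const.mul hG).continuousOn.add (continuousOn_const.mul ?_)
  refine continuousOn_finsetSum _ fun i _ => continuousOn_finsetSum _ fun j _ =>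
    continuousOn_const.mul (continuousOn_xOfp_mul_nextLaw
      (φ := fun p => f p (nextLaw N q y j)) hM hp ?_ i)
  exact hf.comp (f := fun p => (p, nextLaw N q y j)) (by fun_prop)
    fun p hp => ⟨hp, (nextLaw_mem_Binv hN hq hy j).1⟩

theorem convexOn_payoff (hM : rsK.IsCompatible M) (hN : rsL.IsCompatible N)
    (hα : α ∈ Set.Icc (0 : ℝ) 1)
    (hf : ∀ qst ∈ rsL.Pset, ∀ p ∈ stdSimplex ℝ K, ConvexOn ℝ (rsL.Binv qst) fun q => f p q)
    (hp : p ∈ stdSimplex ℝ K) (hq : q ∈ stdSimplex ℝ L) {x : K → I → ℝ} (hx : x ∈ NR rsK p) :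
    ConvexOn ℝ (NR rsL q : Set (L → J → ℝ)) fun y => payoff M N g α f p q x y := by
  have h := (concaveOn_payoff (g := fun l k j i => -g k l i j) (f := fun q p => -f p q)
    hN hM hα (fun qst hqst p hp => (hf qst hqst p hp).neg) hq hp hx).neg
  refine h.congr fun y _ => ?_
  simp [payoff_swap]

theorem continuousOn_payoff_right (hM : rsK.IsCompatible M) (hN : rsL.IsCompatible N)
    (hf : ContinuousOn (fun pq : (K → ℝ) × (L → ℝ) => f pq.1 pq.2)
      (stdSimplex ℝ K ×ˢ stdSimplex ℝ L))
    (hp : p ∈ stdSimplex ℝ K) (hq : q ∈ stdSimplex ℝ L) {x : K → I → ℝ} (hx : x ∈ NR rsK p) :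
    ContinuousOn (fun y => payoff M N g α f p q x y) (NR rsL q : Set (L → J → ℝ)) := by
  have hswap : ContinuousOn (fun qp : (L → ℝ) × (K → ℝ) => -f qp.2 qp.1)
      (stdSimplex ℝ L ×ˢ stdSimplex ℝ K) :=
    (hf.comp continuous_swap.continuousOn fun _ h => ⟨h.2, h.1⟩).neg
  have h := (continuousOn_payoff (g := fun l k j i => -g k l i j) (f := fun q p => -f p q)
    (α := α) hN hM hswap hq hp hx).neg
  refine h.congr fun y _ => ?_
  simp [payoff_swap]

end Payoff

/-- **The one-shot nonrevealing game has a value (recursive-formula step).**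
For `α ∈ [0,1]` and `f : Δ(K)×Δ(L) → [-1,1]` continuous, concave in `p` on each
`B^{-1}(p*)` and convex in `q` on each `C^{-1}(q*)`, the game with strategy sets
`NR(p)`, `NR(q)` and payoff
`α G(p,q,x,y) + (1-α) ∑_{i,j} x(p)(i) y(q)(j) f(p⃗(x,i)M, q⃗(y,j)N)`
has a value: `sup inf = inf sup`, and the outer sup and inf are attained. -/
theorem nonrevealing_one_shot_value {K L I J : Type*}
    [Fintype K] [Nonempty K] [Fintype L] [Nonempty L]
    [Fintype I] [Nonempty I] [Fintype J] [Nonempty J] {RK RL : ℕ}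
    (rsK : RecStruct K RK) (rsL : RecStruct L RL)
    (M : K → K → ℝ) (N : L → L → ℝ)
    (hM : rsK.IsCompatible M) (hN : rsL.IsCompatible N)
    (g : K → L → I → J → ℝ) (hg : ∀ k l i j, g k l i j ∈ Set.Icc (-1 : ℝ) 1)
    (α : ℝ) (hα : α ∈ Set.Icc (0 : ℝ) 1)
    (f : (K → ℝ) → (L → ℝ) → ℝ)
    (hf_cont : ContinuousOn (fun pq : (K → ℝ) × (L → ℝ) => f pq.1 pq.2)
      (stdSimplex ℝ K ×ˢ stdSimplex ℝ L))
    (hf_bd : ∀ p ∈ stdSimplex ℝ K, ∀ q ∈ stdSimplex ℝ L, f p q ∈ Set.Icc (-1 : ℝ) 1)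
    (hf_conc : ∀ pst ∈ rsK.Pset, ∀ q ∈ stdSimplex ℝ L,
      ConcaveOn ℝ (rsK.Binv pst) (fun p => f p q))
    (hf_conv : ∀ qst ∈ rsL.Pset, ∀ p ∈ stdSimplex ℝ K,
      ConvexOn ℝ (rsL.Binv qst) (fun q => f p q))
    (p : K → ℝ) (hp : p ∈ stdSimplex ℝ K) (q : L → ℝ) (hq : q ∈ stdSimplex ℝ L) :
    (sSup {v : ℝ | ∃ x ∈ (NR rsK p : Set (K → I → ℝ)),
        v = sInf {u : ℝ | ∃ y ∈ (NR rsL q : Set (L → J → ℝ)),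
          u = payoff M N g α f p q x y}}
      = sInf {v : ℝ | ∃ y ∈ (NR rsL q : Set (L → J → ℝ)),
        v = sSup {u : ℝ | ∃ x ∈ (NR rsK p : Set (K → I → ℝ)),
          u = payoff M N g α f p q x y}}) ∧
    (∃ x₀ ∈ (NR rsK p : Set (K → I → ℝ)),
      sInf {u : ℝ | ∃ y ∈ (NR rsL q : Set (L → J → ℝ)),
          u = payoff M N g α f p q x₀ y}
        = sSup {v : ℝ | ∃ x ∈ (NR rsK p : Set (K → I → ℝ)),
            v = sInf {u : ℝ | ∃ y ∈ (NR rsL q : Set (L → J → ℝ)),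
              u = payoff M N g α f p q x y}}) ∧
    (∃ y₀ ∈ (NR rsL q : Set (L → J → ℝ)),
      sSup {u : ℝ | ∃ x ∈ (NR rsK p : Set (K → I → ℝ)),
          u = payoff M N g α f p q x y₀}
        = sInf {v : ℝ | ∃ y ∈ (NR rsL q : Set (L → J → ℝ)),
            v = sSup {u : ℝ | ∃ x ∈ (NR rsK p : Set (K → I → ℝ)),
              u = payoff M N g α f p q x y}}) := by
  have hcontx : ∀ y ∈ (NR rsL q : Set (L → J → ℝ)),
      ContinuousOn (fun x => payoff M N g α f p q x y) (NR rsK p : Set (K → I → ℝ)) :=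
    fun y hy => continuousOn_payoff hM hN hf_cont hp hq hy
  have hconty : ∀ x ∈ (NR rsK p : Set (K → I → ℝ)),
      ContinuousOn (fun y => payoff M N g α f p q x y) (NR rsL q : Set (L → J → ℝ)) :=
    fun x hx => continuousOn_payoff_right hM hN hf_cont hp hq hx
  obtain ⟨b, hb, a, ha, hab⟩ := Sion.exists_isSaddlePointOn
    (f := fun y x => payoff M N g α f p q x y)
    (nonempty_NR hq) convex_NR isCompact_NR
    (fun x hx => (hconty x hx).lowerSemicontinuousOn)
    (fun x hx => (convexOn_payoff hM hN hα hf_conv hp hq hx).quasiconvexOn)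
    convex_NR (nonempty_NR hp) isCompact_NR
    (fun y hy => (hcontx y hy).upperSemicontinuousOn)
    (fun y hy => (concaveOn_payoff hM hN hα hf_conc hp hq hy).quasiconcaveOn)
  exact value_of_saddlePoint ha hb (fun x hx y hy => hab y hy x hx)
    (fun x hx => isCompact_NR.bddBelow_image (hconty x hx))
    (fun y hy => isCompact_NR.bddAbove_image (hcontx y hy))
end

section
/- Let K and L carry recurrence structures with projection matrices B and C, and let f be a continuous function from Δ(K)×Δ(L) to [−1,1] that is balanced, i.e. f(p,q) = f(pB,qC) for all (p,q). Define v̲ as the pointwise infimum of {w ∈ C^+(f) : w balanced} and v̄ as the pointwise supremum of {w ∈ C^-(f) : w balanced}. Then v̲ = v̄, and this common function w solves the Mertens–Zamir system for f: w(p,q) = vex_II max(w,f)(p,q) and w(p,q) = cav_I min(w,f)(p,q) for all (p,q) ∈ Δ(K)×Δ(L). -/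
/-- `cavI f`, the concavification of `f` in its first variable over `Δ(K)`:
the supremum of `∑ α_m f(p_m, q)` over finite convex decompositions `p = ∑ α_m p_m`
with `p_m ∈ Δ(K)`. -/
noncomputable def cavI {K L : Type*} [Fintype K] (f : (K → ℝ) → (L → ℝ) → ℝ)
    (p : K → ℝ) (q : L → ℝ) : ℝ :=
  sSup {x : ℝ | ∃ (n : ℕ) (α : Fin n → ℝ) (ps : Fin n → K → ℝ),
    (∀ m, 0 ≤ α m) ∧ (∑ m, α m = 1) ∧ (∀ m, ps m ∈ stdSimplex ℝ K) ∧
    (∑ m, α m • ps m = p) ∧ x = ∑ m, α m * f (ps m) q}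

/-- `vexII f`, the convexification of `f` in its second variable over `Δ(L)`:
the infimum of `∑ α_m f(p, q_m)` over finite convex decompositions `q = ∑ α_m q_m`
with `q_m ∈ Δ(L)`. -/
noncomputable def vexII {K L : Type*} [Fintype L] (f : (K → ℝ) → (L → ℝ) → ℝ)
    (p : K → ℝ) (q : L → ℝ) : ℝ :=
  sInf {x : ℝ | ∃ (n : ℕ) (α : Fin n → ℝ) (qs : Fin n → L → ℝ),
    (∀ m, 0 ≤ α m) ∧ (∑ m, α m = 1) ∧ (∀ m, qs m ∈ stdSimplex ℝ L) ∧
    (∑ m, α m • qs m = q) ∧ x = ∑ m, α m * f p (qs m)}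

/-- Membership in `𝒞`: continuous on `Δ(K)×Δ(L)` with values in `[-1,1]` there. -/
def MemC {K L : Type*} [Fintype K] [Fintype L] (f : (K → ℝ) → (L → ℝ) → ℝ) : Prop :=
  ContinuousOn (fun pq : (K → ℝ) × (L → ℝ) => f pq.1 pq.2)
    (stdSimplex ℝ K ×ˢ stdSimplex ℝ L) ∧
  ∀ p ∈ stdSimplex ℝ K, ∀ q ∈ stdSimplex ℝ L, f p q ∈ Set.Icc (-1 : ℝ) 1

/-- Membership in `𝒞⁺(f)`: `w ∈ 𝒞`, `w` is I-concave, and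
`w(p,q) ≥ vex_II max(w,f)(p,q)` on `Δ(K)×Δ(L)`. -/
def memCplus {K L : Type*} [Fintype K] [Fintype L]
    (f w : (K → ℝ) → (L → ℝ) → ℝ) : Prop :=
  MemC w ∧ (∀ q ∈ stdSimplex ℝ L, ConcaveOn ℝ (stdSimplex ℝ K) (fun p => w p q)) ∧
  ∀ p ∈ stdSimplex ℝ K, ∀ q ∈ stdSimplex ℝ L,
    vexII (fun p' q' => max (w p' q') (f p' q')) p q ≤ w p q

/-- Membership in `𝒞⁻(f)`: `w ∈ 𝒞`, `w` is II-convex, and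
`w(p,q) ≤ cav_I min(w,f)(p,q)` on `Δ(K)×Δ(L)`. -/
def memCminus {K L : Type*} [Fintype K] [Fintype L]
    (f w : (K → ℝ) → (L → ℝ) → ℝ) : Prop :=
  MemC w ∧ (∀ p ∈ stdSimplex ℝ K, ConvexOn ℝ (stdSimplex ℝ L) (fun q => w p q)) ∧
  ∀ p ∈ stdSimplex ℝ K, ∀ q ∈ stdSimplex ℝ L,
    w p q ≤ cavI (fun p' q' => min (w p' q') (f p' q')) p q

/-- A function `w` on `Δ(K)×Δ(L)` is balanced if `w(p,q) = w(pB, qC)`. -/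
def BalancedFn {K L : Type*} [Fintype K] [Fintype L] {RK RL : ℕ}
    (rsK : RecStruct K RK) (rsL : RecStruct L RL)
    (w : (K → ℝ) → (L → ℝ) → ℝ) : Prop :=
  ∀ p ∈ stdSimplex ℝ K, ∀ q ∈ stdSimplex ℝ L,
    w p q = w (vecMulF p rsK.Bmat) (vecMulF q rsL.Bmat)

namespace MertensZamir

open Finset

/-- `ps` with weights `α` is a finite convex decomposition of `p` in the simplex. -/
structure IsSplit {ι K : Type*} [Fintype ι] [Fintype K] (α : ι → ℝ) (ps : ι → K → ℝ)
    (p : K → ℝ) : Prop where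
  nonneg : ∀ m, 0 ≤ α m
  sum_one : ∑ m, α m = 1
  mem : ∀ m, ps m ∈ stdSimplex ℝ K
  bary : ∑ m, α m • ps m = p

/-- Exchanging the roles of the two players. -/
def negSwap {K L : Type*} (g : (K → ℝ) → (L → ℝ) → ℝ) : (L → ℝ) → (K → ℝ) → ℝ :=
  fun q p => - g p q

/-- `g` takes values in `[-1,1]` on the product of simplices. -/
def Ranged {K L : Type*} [Fintype K] [Fintype L] (g : (K → ℝ) → (L → ℝ) → ℝ) : Prop :=
  ∀ p ∈ stdSimplex ℝ K, ∀ q ∈ stdSimplex ℝ L, g p q ∈ Set.Icc (-1 : ℝ) 1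

/-- Concavity in the first variable. -/
def IConcave {K L : Type*} [Fintype K] [Fintype L] (g : (K → ℝ) → (L → ℝ) → ℝ) : Prop :=
  ∀ q ∈ stdSimplex ℝ L, ConcaveOn ℝ (stdSimplex ℝ K) (fun p => g p q)

/-- Affine moduli of continuity in the first variable, indexed by pairs (offset, slope). -/
def ModI {K L : Type*} [Fintype K] [Fintype L] (A : Set (ℝ × ℝ))
    (g : (K → ℝ) → (L → ℝ) → ℝ) : Prop :=
  ∀ a ∈ A, ∀ p ∈ stdSimplex ℝ K, ∀ p' ∈ stdSimplex ℝ K, ∀ q ∈ stdSimplex ℝ L,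
    g p q - g p' q ≤ a.1 + a.2 * dist1 p p'

@[simp] lemma negSwap_negSwap {K L : Type*} (g : (K → ℝ) → (L → ℝ) → ℝ) : negSwap (negSwap g) = g := by
  funext p q; simp [negSwap]

lemma vexII_eq {K L : Type*} [Fintype L] (g : (K → ℝ) → (L → ℝ) → ℝ) : vexII g = negSwap (cavI (negSwap g)) := by
  funext p q
  unfold vexII negSwap cavI
  rw [Real.sInf_def]
  congr 2
  ext x
  simp only [Set.mem_neg, Set.mem_ofPred_eq, mul_neg, Finset.sum_neg_distrib, neg_eq_iff_eq_neg]

lemma IsSplit.trivial {K : Type*} [Fintype K] {p : K → ℝ} (hp : p ∈ stdSimplex ℝ K) :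
    IsSplit (fun _ : Fin 1 => (1 : ℝ)) (fun _ => p) p :=
  ⟨fun _ => zero_le_one, by simp, fun _ => hp, by simp⟩

lemma cavI_le {K L : Type*} [Fintype K] {g : (K → ℝ) → (L → ℝ) → ℝ} {p : K → ℝ} {q : L → ℝ}
    (hp : p ∈ stdSimplex ℝ K) {c : ℝ}
    (H : ∀ (n : ℕ) (α : Fin n → ℝ) (ps : Fin n → K → ℝ), IsSplit α ps p →
      ∑ m, α m * g (ps m) q ≤ c) : cavI g p q ≤ c := by
  refine csSup_le ?_ ?_
  · have h := IsSplit.trivial hp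
    exact ⟨_, 1, _, _, h.nonneg, h.sum_one, h.mem, h.bary, rfl⟩
  · rintro x ⟨n, α, ps, h1, h2, h3, h4, rfl⟩
    exact H n α ps ⟨h1, h2, h3, h4⟩

lemma exists_split_cavI {K L : Type*} [Fintype K] {p : K → ℝ}
    (hp : p ∈ stdSimplex ℝ K) (g : (K → ℝ) → (L → ℝ) → ℝ) (q : L → ℝ)
    {ε : ℝ} (hε : 0 < ε) :
    ∃ (n : ℕ) (α : Fin n → ℝ) (ps : Fin n → K → ℝ), IsSplit α ps p ∧
      cavI g p q - ε ≤ ∑ m, α m * g (ps m) q := by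
  by_contra! hcon
  have := cavI_le (g := g) (q := q) hp (c := cavI g p q - ε)
    fun n α ps h => (hcon n α ps h).le
  linarith

lemma cavI_congr {K L : Type*} [Fintype K] {g g' : (K → ℝ) → (L → ℝ) → ℝ} {q : L → ℝ}
    (H : ∀ p ∈ stdSimplex ℝ K, g p q = g' p q) (p : K → ℝ) :
    cavI g p q = cavI g' p q := by
  unfold cavI
  congr 1
  ext x
  constructor <;> rintro ⟨n, α, ps, h1, h2, h3, h4, rfl⟩ <;>
    exact ⟨n, α, ps, h1, h2, h3, h4, Finset.sum_congr rfl fun m _ => by rw [H _ (h3 m)]⟩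

section Basic

variable {ι K L : Type*} [Fintype ι] [Fintype K] [Fintype L]
  {α : ι → ℝ} {ps : ι → K → ℝ} {p : K → ℝ} {q : L → ℝ} {g g' : (K → ℝ) → (L → ℝ) → ℝ}

lemma Ranged.negSwap (h : Ranged g) : Ranged (negSwap g) := by
  intro q hq p hp
  have := h p hp q hq
  simp only [MertensZamir.negSwap, Set.mem_Icc] at *
  constructor <;> linarith [this.1, this.2]

lemma IsSplit.bary_apply (h : IsSplit α ps p) (k : K) : ∑ m, α m * ps m k = p k := by
  rw [← h.bary]; simp

lemma IsSplit.bary_mem (h : IsSplit α ps p) : p ∈ stdSimplex ℝ K := by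
  rw [← h.bary]
  exact (convex_stdSimplex ℝ K).sum_mem (fun m _ => h.nonneg m) h.sum_one (fun m _ => h.mem m)

lemma IsSplit.sum_const (h : IsSplit α ps p) (c : ℝ) : ∑ m, α m * c = c := by
  rw [← Finset.sum_mul, h.sum_one, one_mul]

lemma IsSplit.sum_le_sum (h : IsSplit α ps p) {x y : ι → ℝ} (hxy : ∀ m, x m ≤ y m) :
    ∑ m, α m * x m ≤ ∑ m, α m * y m :=
  Finset.sum_le_sum fun m _ => mul_le_mul_of_nonneg_left (hxy m) (h.nonneg m)

lemma IsSplit.sum_le (h : IsSplit α ps p) {x : ι → ℝ} {c : ℝ} (hx : ∀ m, x m ≤ c) :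
    ∑ m, α m * x m ≤ c :=
  (h.sum_le_sum hx).trans_eq (h.sum_const c)

lemma IConcave.sum_le (hg : IConcave g) (h : IsSplit α ps p) (hq : q ∈ stdSimplex ℝ L) :
    ∑ m, α m * g (ps m) q ≤ g p q := by
  have := (hg q hq).le_map_sum (t := Finset.univ) (w := α) (p := ps)
    (fun m _ => h.nonneg m) h.sum_one (fun m _ => h.mem m)
  rw [h.bary] at this
  simpa using this

lemma bddAbove_cavI (hg : Ranged g) (p : K → ℝ) (hq : q ∈ stdSimplex ℝ L) :
    BddAbove {x : ℝ | ∃ (n : ℕ) (α : Fin n → ℝ) (ps : Fin n → K → ℝ),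
    (∀ m, 0 ≤ α m) ∧ (∑ m, α m = 1) ∧ (∀ m, ps m ∈ stdSimplex ℝ K) ∧
    (∑ m, α m • ps m = p) ∧ x = ∑ m, α m * g (ps m) q} := by
  refine ⟨1, ?_⟩
  rintro x ⟨n, α, ps, h1, h2, h3, h4, rfl⟩
  exact (IsSplit.mk h1 h2 h3 h4).sum_le fun m => (hg _ (h3 m) _ hq).2

lemma le_cavI (hg : Ranged g) (h : IsSplit α ps p) (hq : q ∈ stdSimplex ℝ L) :
    ∑ m, α m * g (ps m) q ≤ cavI g p q := by
  refine le_csSup (bddAbove_cavI hg p hq) ?_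
  let e := (Fintype.equivFin ι).symm
  refine ⟨Fintype.card ι, α ∘ e, ps ∘ e, fun m => h.nonneg _, ?_, fun m => h.mem _, ?_, ?_⟩
  · rw [← h.sum_one]; exact e.sum_comp α
  · rw [← h.bary]; exact e.sum_comp fun m => α m • ps m
  · exact (e.sum_comp fun m => α m * g (ps m) q).symm

lemma self_le_cavI (hg : Ranged g) (hp : p ∈ stdSimplex ℝ K) (hq : q ∈ stdSimplex ℝ L) :
    g p q ≤ cavI g p q := by
  simpa using le_cavI hg (IsSplit.trivial hp) hq

lemma ranged_cavI (hg : Ranged g) : Ranged (cavI g) := by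
  intro p hp q hq
  exact ⟨(hg p hp q hq).1.trans (self_le_cavI hg hp hq),
    cavI_le hp fun n α ps h => h.sum_le fun m => (hg _ (h.mem m) _ hq).2⟩

lemma cavI_le_add (hg' : Ranged g') {c : ℝ}
    (H : ∀ p ∈ stdSimplex ℝ K, ∀ q ∈ stdSimplex ℝ L, g p q ≤ g' p q + c)
    (hp : p ∈ stdSimplex ℝ K) (hq : q ∈ stdSimplex ℝ L) : cavI g p q ≤ cavI g' p q + c := by
  refine cavI_le hp fun n α ps h => ?_
  calc ∑ m, α m * g (ps m) q ≤ ∑ m, α m * (g' (ps m) q + c) :=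
        h.sum_le_sum fun m => H _ (h.mem m) _ hq
    _ = ∑ m, α m * g' (ps m) q + c := by
        simp only [mul_add, Finset.sum_add_distrib, h.sum_const]
    _ ≤ _ := by linarith [le_cavI hg' h hq]

lemma iConcave_cavI (hg : Ranged g) : IConcave (cavI g) := by
  intro q hq
  refine ⟨convex_stdSimplex ℝ K, ?_⟩
  intro p₁ hp₁ p₂ hp₂ a b ha hb hab
  refine le_of_forall_pos_le_add fun ε hε => ?_
  obtain ⟨n₁, α₁, ps₁, h₁, e₁⟩ := exists_split_cavI hp₁ g q hε
  obtain ⟨n₂, α₂, ps₂, h₂, e₂⟩ := exists_split_cavI hp₂ g q hε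
  have h : IsSplit (Sum.elim (fun m => a * α₁ m) (fun m => b * α₂ m)) (Sum.elim ps₁ ps₂)
      (a • p₁ + b • p₂) := by
    refine ⟨?_, ?_, ?_, ?_⟩
    · rintro (m | m)
      · exact mul_nonneg ha (h₁.nonneg m)
      · exact mul_nonneg hb (h₂.nonneg m)
    · simp [← Finset.mul_sum, h₁.sum_one, h₂.sum_one, hab]
    · rintro (m | m)
      · exact h₁.mem m
      · exact h₂.mem m
    · simp [mul_smul, ← Finset.smul_sum, h₁.bary, h₂.bary]
  have h3 := le_cavI hg h hq
  simp only [Fintype.sum_sum_type, Sum.elim_inl, Sum.elim_inr, mul_assoc,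
    ← Finset.mul_sum] at h3
  simp only [smul_eq_mul]
  have i1 := mul_le_mul_of_nonneg_left e₁ ha
  have i2 := mul_le_mul_of_nonneg_left e₂ hb
  have i3 : a * ε + b * ε = ε := by rw [← add_mul, hab, one_mul]
  linarith

lemma iConvex_cavI (hg : Ranged g) (hc : IConcave (negSwap g)) :
    IConcave (negSwap (cavI g)) := by
  intro p hp
  refine ⟨convex_stdSimplex ℝ L, ?_⟩
  intro q₁ hq₁ q₂ hq₂ a b ha hb hab
  simp only [negSwap, smul_eq_mul]
  have : cavI g p (a • q₁ + b • q₂) ≤ a * cavI g p q₁ + b * cavI g p q₂ := by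
    refine cavI_le hp fun n α ps h => ?_
    calc ∑ m, α m * g (ps m) (a • q₁ + b • q₂)
        ≤ ∑ m, α m * (a * g (ps m) q₁ + b * g (ps m) q₂) := by
          refine h.sum_le_sum fun m => ?_
          have := (hc (ps m) (h.mem m)).2 hq₁ hq₂ ha hb hab
          simp only [negSwap, smul_eq_mul] at this
          linarith
      _ = a * ∑ m, α m * g (ps m) q₁ + b * ∑ m, α m * g (ps m) q₂ := by
          rw [Finset.mul_sum, Finset.mul_sum, ← Finset.sum_add_distrib]
          exact Finset.sum_congr rfl fun m _ => by ring
      _ ≤ _ := add_le_add (mul_le_mul_of_nonneg_left (le_cavI hg h hq₁) ha)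
          (mul_le_mul_of_nonneg_left (le_cavI hg h hq₂) hb)
  linarith

end Basic

section Modulus

variable {K L : Type*} [Fintype K] [Fintype L]

lemma dist1_comm (p p' : K → ℝ) : dist1 p p' = dist1 p' p :=
  Finset.sum_congr rfl fun _ _ => abs_sub_comm _ _

/-- Any decomposition of `p` can be moved to a decomposition of `p'` with the same weights, at an
average `L¹` cost equal to the distance from `p` to `p'`. -/
lemma IsSplit.exists_transport {ι : Type*} [Fintype ι] {α : ι → ℝ} {ps : ι → K → ℝ}
    {p p' : K → ℝ} (h : IsSplit α ps p) (hp' : p' ∈ stdSimplex ℝ K) :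
    ∃ ps' : ι → K → ℝ, IsSplit α ps' p' ∧
      ∑ m, α m * dist1 (ps m) (ps' m) ≤ dist1 p p' := by
  have hp := h.bary_mem
  set u : K → ℝ := fun k => min (p k) (p' k) with hu
  set t : K → ℝ := fun k => u k / p k with ht
  have hu0 : ∀ k, 0 ≤ u k := fun k => le_min (hp.1 k) (hp'.1 k)
  have htp : ∀ k, t k * p k = u k := by
    intro k
    rcases eq_or_ne (p k) 0 with h0 | h0
    · have : u k = 0 := le_antisymm ((min_le_left _ _).trans h0.le) (hu0 k)
      simp [h0, this]
    · simp only [ht]; field_simp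
  have ht0 : ∀ k, 0 ≤ t k := fun k => div_nonneg (hu0 k) (hp.1 k)
  have ht1 : ∀ k, t k ≤ 1 := fun k => div_le_one_of_le₀ (min_le_left _ _) (hp.1 k)
  set s : ℝ := ∑ k, (p k - u k) with hs
  have hs' : ∑ k, (p' k - u k) = s := by
    simp only [hs, Finset.sum_sub_distrib, hp.2, hp'.2]
  have hs0 : 0 ≤ s := Finset.sum_nonneg fun k _ => sub_nonneg.2 (min_le_left _ _)
  have hd : dist1 p p' = 2 * s := by
    have : dist1 p p' = ∑ k, ((p k - u k) + (p' k - u k)) := by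
      refine Finset.sum_congr rfl fun k _ => ?_
      simp only [hu]
      rcases le_total (p k) (p' k) with h1 | h1
      · rw [min_eq_left h1, abs_of_nonpos (by linarith)]; ring
      · rw [min_eq_right h1, abs_of_nonneg (by linarith)]; ring
    rw [this, Finset.sum_add_distrib, hs']; ring
  obtain ⟨r, hr, hsr⟩ : ∃ r ∈ stdSimplex ℝ K, ∀ k, s * r k = p' k - u k := by
    rcases eq_or_lt_of_le hs0 with h0 | h0
    · refine ⟨p', hp', fun k => ?_⟩
      rw [← h0] at hs'
      have := (Finset.sum_eq_zero_iff_of_nonneg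
        (fun k _ => sub_nonneg.2 (min_le_right (p k) (p' k)))).1 hs' k (Finset.mem_univ k)
      rw [← h0, zero_mul]; exact this.symm
    · refine ⟨fun k => (p' k - u k) / s, ⟨fun k => ?_, ?_⟩, fun k => ?_⟩
      · exact div_nonneg (sub_nonneg.2 (min_le_right _ _)) hs0
      · rw [← Finset.sum_div, hs', div_self h0.ne']
      · field_simp
  set c : ι → ℝ := fun m => ∑ k, (1 - t k) * ps m k with hc
  have hc0 : ∀ m, 0 ≤ c m := fun m => Finset.sum_nonneg fun k _ =>
    mul_nonneg (sub_nonneg.2 (ht1 k)) ((h.mem m).1 k)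
  have hcs : ∑ m, α m * c m = s := by
    simp only [hc, Finset.mul_sum]
    rw [Finset.sum_comm, hs]
    refine Finset.sum_congr rfl fun k _ => ?_
    rw [← htp k]
    calc ∑ m, α m * ((1 - t k) * ps m k) = (1 - t k) * ∑ m, α m * ps m k := by
          rw [Finset.mul_sum]; exact Finset.sum_congr rfl fun m _ => by ring
      _ = _ := by rw [h.bary_apply]; ring
  refine ⟨fun m k => t k * ps m k + c m * r k, ⟨h.nonneg, h.sum_one, fun m => ⟨fun k => ?_, ?_⟩,
    ?_⟩, ?_⟩
  · exact add_nonneg (mul_nonneg (ht0 k) ((h.mem m).1 k)) (mul_nonneg (hc0 m) (hr.1 k))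
  · rw [Finset.sum_add_distrib, ← Finset.mul_sum, hr.2, mul_one, ← Finset.sum_add_distrib]
    refine Eq.trans ?_ (h.mem m).2
    exact Finset.sum_congr rfl fun k _ => by ring
  · funext k
    simp only [Finset.sum_apply, Pi.smul_apply, smul_eq_mul, mul_add, Finset.sum_add_distrib]
    have e1 : ∑ m, α m * (t k * ps m k) = t k * p k := by
      rw [← h.bary_apply, Finset.mul_sum]; exact Finset.sum_congr rfl fun m _ => by ring
    have e2 : ∑ m, α m * (c m * r k) = s * r k := by
      rw [← hcs, Finset.sum_mul]; exact Finset.sum_congr rfl fun m _ => by ring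
    rw [e1, e2, htp, hsr]; ring
  · rw [hd, ← hcs, Finset.mul_sum]
    refine Finset.sum_le_sum fun m _ => ?_
    have : dist1 (ps m) (fun k => t k * ps m k + c m * r k) ≤ 2 * c m := by
      calc dist1 (ps m) (fun k => t k * ps m k + c m * r k)
          ≤ ∑ k, ((1 - t k) * ps m k + c m * r k) := by
            refine Finset.sum_le_sum fun k _ => ?_
            have i1 := mul_nonneg (sub_nonneg.2 (ht1 k)) ((h.mem m).1 k)
            have i2 := mul_nonneg (hc0 m) (hr.1 k)
            rw [abs_le]; constructor <;> nlinarith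
        _ = 2 * c m := by
            rw [Finset.sum_add_distrib, ← Finset.mul_sum, hr.2]; ring
    nlinarith [h.nonneg m]

variable {A : Set (ℝ × ℝ)} {g : (K → ℝ) → (L → ℝ) → ℝ}

lemma modI_cavI (hA : ∀ a ∈ A, 0 ≤ a.2) (hg : Ranged g) (hm : ModI A g) : ModI A (cavI g) := by
  intro a ha p hp p' hp' q hq
  suffices cavI g p q ≤ cavI g p' q + (a.1 + a.2 * dist1 p p') by linarith
  refine cavI_le hp fun n α ps h => ?_
  obtain ⟨ps', h', hd⟩ := h.exists_transport hp'
  have h1 := le_cavI hg h' hq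
  calc ∑ m, α m * g (ps m) q
      ≤ ∑ m, α m * (g (ps' m) q + (a.1 + a.2 * dist1 (ps m) (ps' m))) :=
        h.sum_le_sum fun m => by linarith [hm a ha _ (h.mem m) _ (h'.mem m) q hq]
    _ = ∑ m, α m * g (ps' m) q + (a.1 + a.2 * ∑ m, α m * dist1 (ps m) (ps' m)) := by
        simp only [mul_add, Finset.sum_add_distrib, h.sum_const, Finset.mul_sum]
        congr 2
        exact Finset.sum_congr rfl fun m _ => by ring
    _ ≤ _ := by linarith [mul_le_mul_of_nonneg_left hd (hA a ha)]

lemma modII_cavI (hg : Ranged g) (hm : ModI A (negSwap g)) :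
    ModI A (negSwap (cavI g)) := by
  intro a ha q hq q' hq' p hp
  simp only [negSwap]
  suffices cavI g p q' ≤ cavI g p q + (a.1 + a.2 * dist1 q q') by linarith
  refine cavI_le hp fun n α ps h => ?_
  have h1 := le_cavI hg h hq
  calc ∑ m, α m * g (ps m) q' ≤ ∑ m, α m * (g (ps m) q + (a.1 + a.2 * dist1 q q')) := by
        refine h.sum_le_sum fun m => ?_
        have := hm a ha q hq q' hq' (ps m) (h.mem m)
        simp only [negSwap] at this
        linarith
    _ = ∑ m, α m * g (ps m) q + (a.1 + a.2 * dist1 q q') := by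
        simp only [mul_add _ (g _ _), Finset.sum_add_distrib, h.sum_const]
    _ ≤ _ := by linarith

end Modulus

section Balanced

variable {K L : Type*} [Fintype K] [Fintype L] {RK RL : ℕ}

lemma vecMulF_vecMulF (p : K → ℝ) (M N : K → K → ℝ) :
    vecMulF (vecMulF p M) N = vecMulF p (fun k => vecMulF (M k) N) := by
  funext k'
  simp only [vecMulF, Finset.sum_mul, Finset.mul_sum]
  rw [Finset.sum_comm]
  exact Finset.sum_congr rfl fun _ _ => Finset.sum_congr rfl fun _ _ => by ring

lemma vecMulF_mem {p : K → ℝ} {M : K → K → ℝ} (hp : p ∈ stdSimplex ℝ K)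
    (hM : ∀ k, M k ∈ stdSimplex ℝ K) : vecMulF p M ∈ stdSimplex ℝ K := by
  refine ⟨fun k => Finset.sum_nonneg fun j _ => mul_nonneg (hp.1 j) ((hM j).1 k), ?_⟩
  simp only [vecMulF]
  rw [Finset.sum_comm]
  simp only [← Finset.mul_sum, (hM _).2, mul_one, hp.2]

lemma IsSplit.vecMulF {ι : Type*} [Fintype ι] {α : ι → ℝ} {ps : ι → K → ℝ} {p : K → ℝ}
    {M : K → K → ℝ} (h : IsSplit α ps p) (hM : ∀ k, M k ∈ stdSimplex ℝ K) :
    IsSplit α (fun m => vecMulF (ps m) M) (vecMulF p M) := by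
  refine ⟨h.nonneg, h.sum_one, fun m => vecMulF_mem (h.mem m) hM, ?_⟩
  funext k
  simp only [Finset.sum_apply, Pi.smul_apply, smul_eq_mul, _root_.vecMulF, ← h.bary_apply,
    Finset.sum_mul, Finset.mul_sum]
  rw [Finset.sum_comm]
  exact Finset.sum_congr rfl fun _ _ => Finset.sum_congr rfl fun _ _ => by ring

lemma Bmat_mem (rs : RecStruct K RK) (k : K) : rs.Bmat k ∈ stdSimplex ℝ K :=
  rs.pstar_mem _

/-- A probability vector supported in class `r` averages a class-dependent family of rows to the
row of that class. -/
lemma vecMulF_of_supp (rs : RecStruct K RK) {x : K → ℝ} (hx : x ∈ stdSimplex ℝ K) {r : Fin RK}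
    (hs : ∀ k, x k ≠ 0 → rs.cls k = r) (N : Fin RK → K → ℝ) :
    vecMulF x (fun k => N (rs.cls k)) = N r := by
  funext k'
  have : ∀ k, x k * N (rs.cls k) k' = x k * N r k' := by
    intro k
    by_cases h0 : x k = 0
    · simp [h0]
    · rw [hs k h0]
  simp only [vecMulF, this, ← Finset.sum_mul, hx.2, one_mul]

lemma vecMulF_Bmat_Bmat (rs : RecStruct K RK) (p : K → ℝ) :
    vecMulF (vecMulF p rs.Bmat) rs.Bmat = vecMulF p rs.Bmat := by
  rw [vecMulF_vecMulF]
  congr 1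
  funext k
  exact vecMulF_of_supp rs (rs.pstar_mem _) (rs.pstar_supp _) rs.pstar

lemma lam_nonneg (rs : RecStruct K RK) {p : K → ℝ} (hp : p ∈ stdSimplex ℝ K) (r : Fin RK) :
    0 ≤ rs.lam p r :=
  Finset.sum_nonneg fun k _ => by split_ifs <;> simp [hp.1 k]

lemma cond_mem (rs : RecStruct K RK) {p : K → ℝ} (hp : p ∈ stdSimplex ℝ K) (r : Fin RK) :
    rs.cond p r ∈ stdSimplex ℝ K := by
  unfold RecStruct.cond
  split_ifs with h
  · refine ⟨fun k => ?_, ?_⟩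
    · dsimp only; split_ifs
      · exact div_nonneg (hp.1 k) h.le
      · exact le_rfl
    · have : ∀ k, (if rs.cls k = r then p k / rs.lam p r else 0)
          = (if rs.cls k = r then p k else 0) / rs.lam p r := by
        intro k; split_ifs <;> simp
      simp only [this, ← Finset.sum_div]
      exact div_self h.ne'
  · exact rs.pstar_mem r

lemma cond_supp (rs : RecStruct K RK) (p : K → ℝ) (r : Fin RK) (k : K)
    (h : rs.cond p r k ≠ 0) : rs.cls k = r := by
  unfold RecStruct.cond at h
  split_ifs at h with h1
  · by_contra h2; simp [h2] at h
  · exact rs.pstar_supp r k h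

lemma lam_mul_cond (rs : RecStruct K RK) {p : K → ℝ} (hp : p ∈ stdSimplex ℝ K) (k : K) :
    rs.lam p (rs.cls k) * rs.cond p (rs.cls k) k = p k := by
  unfold RecStruct.cond
  split_ifs with h
  · simp only [if_true]; field_simp
  · have h0 : rs.lam p (rs.cls k) = 0 := le_antisymm (not_lt.1 h) (lam_nonneg rs hp _)
    rw [h0, zero_mul]
    have := (Finset.sum_eq_zero_iff_of_nonneg (fun j _ => by
      split_ifs <;> simp [hp.1 j])).1 h0 k (Finset.mem_univ k)
    simpa using this.symm

lemma vecMulF_Bmat_cond (rs : RecStruct K RK) {p : K → ℝ} (hp : p ∈ stdSimplex ℝ K) :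
    vecMulF (vecMulF p rs.Bmat) (fun k => rs.cond p (rs.cls k)) = p := by
  have : vecMulF (vecMulF p rs.Bmat) (fun k => rs.cond p (rs.cls k))
      = vecMulF p (fun k => rs.cond p (rs.cls k)) := by
    rw [vecMulF_vecMulF]
    congr 1
    funext k
    exact vecMulF_of_supp rs (rs.pstar_mem _) (rs.pstar_supp _) (rs.cond p)
  rw [this]
  funext k'
  rw [← lam_mul_cond rs hp k', RecStruct.lam, Finset.sum_mul]
  refine Finset.sum_congr rfl fun k _ => ?_
  split_ifs with h
  · dsimp only
    rw [h]
  · rw [zero_mul]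
    by_contra h2
    exact h (cond_supp rs p _ _ (right_ne_zero_of_mul h2)).symm

lemma vecMulF_cond_Bmat (rs : RecStruct K RK) {p : K → ℝ} (hp : p ∈ stdSimplex ℝ K)
    (x : K → ℝ) :
    vecMulF (vecMulF x (fun k => rs.cond p (rs.cls k))) rs.Bmat = vecMulF x rs.Bmat := by
  rw [vecMulF_vecMulF]
  congr 1
  funext k
  exact vecMulF_of_supp rs (cond_mem rs hp _) (cond_supp rs p _) rs.pstar

variable {rsK : RecStruct K RK} {rsL : RecStruct L RL} {g : (K → ℝ) → (L → ℝ) → ℝ}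

lemma balanced_negSwap (hb : BalancedFn rsK rsL g) : BalancedFn rsL rsK (negSwap g) :=
  fun q hq p hp => congrArg Neg.neg (hb p hp q hq)

lemma balanced_cavI (hg : Ranged g) (hb : BalancedFn rsK rsL g) :
    BalancedFn rsK rsL (cavI g) := by
  intro p hp q hq
  have hpB := vecMulF_mem hp (Bmat_mem rsK)
  have hqC := vecMulF_mem hq (Bmat_mem rsL)
  refine le_antisymm (cavI_le hp fun n α ps h => ?_) (cavI_le hpB fun n α ps h => ?_)
  · refine le_of_eq_of_le ?_ (le_cavI hg (h.vecMulF (Bmat_mem rsK)) hqC)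
    exact Finset.sum_congr rfl fun m _ => by rw [hb _ (h.mem m) q hq]
  · have h' := h.vecMulF (fun k => cond_mem rsK hp (rsK.cls k))
    rw [vecMulF_Bmat_cond rsK hp] at h'
    refine le_of_eq_of_le ?_ (le_cavI hg h' hq)
    refine Finset.sum_congr rfl fun m _ => ?_
    rw [hb _ (h'.mem m) q hq, vecMulF_cond_Bmat rsK hp, hb _ (h.mem m) _ hqC,
      vecMulF_Bmat_Bmat rsL]

end Balanced

/-- Functions with prescribed affine moduli in both variables which are balanced and take values
in `[-1,1]`. -/
structure Good {K L : Type*} [Fintype K] [Fintype L] {RK RL : ℕ} (A : Set (ℝ × ℝ))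
    (rsK : RecStruct K RK) (rsL : RecStruct L RL) (g : (K → ℝ) → (L → ℝ) → ℝ) : Prop where
  ranged : Ranged g
  modI : ModI A g
  modII : ModI A (negSwap g)
  balanced : BalancedFn rsK rsL g

/-- Up to `η`, player I can split `p` so that on average neither `v` nor `f` falls below `v(p,q)`. -/
def Sub {K L : Type*} [Fintype K] [Fintype L] (η : ℝ) (v f : (K → ℝ) → (L → ℝ) → ℝ) : Prop :=
  ∀ p ∈ stdSimplex ℝ K, ∀ q ∈ stdSimplex ℝ L,
    ∃ (n : ℕ) (α : Fin n → ℝ) (ps : Fin n → K → ℝ), IsSplit α ps p ∧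
      v p q - η ≤ ∑ m, α m * v (ps m) q ∧ v p q - η ≤ ∑ m, α m * f (ps m) q

section GoodFunctions

variable {K L : Type*} [Fintype K] [Fintype L] {RK RL : ℕ} {A : Set (ℝ × ℝ)}
  {rsK : RecStruct K RK} {rsL : RecStruct L RL} {f g g' : (K → ℝ) → (L → ℝ) → ℝ}

lemma Sub.mono {η η' : ℝ} (h : η ≤ η') (hs : Sub η g f) : Sub η' g f := by
  intro p hp q hq
  obtain ⟨n, α, ps, h1, h2, h3⟩ := hs p hp q hq
  exact ⟨n, α, ps, h1, by linarith, by linarith⟩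

lemma Good.negSwap (h : Good A rsK rsL g) : Good A rsL rsK (negSwap g) :=
  ⟨h.ranged.negSwap, h.modII, by simpa using h.modI, balanced_negSwap h.balanced⟩

lemma Good.cavI (hA : ∀ a ∈ A, 0 ≤ a.2) (h : Good A rsK rsL g) : Good A rsK rsL (cavI g) :=
  ⟨ranged_cavI h.ranged, modI_cavI hA h.ranged h.modI, modII_cavI h.ranged h.modII,
    balanced_cavI h.ranged h.balanced⟩

lemma Good.vexII (hA : ∀ a ∈ A, 0 ≤ a.2) (h : Good A rsK rsL g) : Good A rsK rsL (vexII g) := by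
  rw [vexII_eq]
  exact (h.negSwap.cavI hA).negSwap

lemma ModI.convexComb {x y : ℝ} (hx : 0 ≤ x) (hy : 0 ≤ y) (hxy : x + y = 1) (h : ModI A g)
    (h' : ModI A g') : ModI A (fun p q => x * g p q + y * g' p q) := by
  intro a ha p hp p' hp' q hq
  have h1 := mul_le_mul_of_nonneg_left (h a ha p hp p' hp' q hq) hx
  have h2 := mul_le_mul_of_nonneg_left (h' a ha p hp p' hp' q hq) hy
  have h3 : x * (a.1 + a.2 * dist1 p p') + y * (a.1 + a.2 * dist1 p p')
      = a.1 + a.2 * dist1 p p' := by rw [← add_mul, hxy, one_mul]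
  dsimp only
  linarith

lemma Ranged.convexComb {x y : ℝ} (hx : 0 ≤ x) (hy : 0 ≤ y) (hxy : x + y = 1) (h : Ranged g)
    (h' : Ranged g') : Ranged (fun p q => x * g p q + y * g' p q) :=
  fun p hp q hq => convex_Icc (-1 : ℝ) 1 (h p hp q hq) (h' p hp q hq) hx hy hxy

lemma Good.convexComb {x y : ℝ} (hx : 0 ≤ x) (hy : 0 ≤ y) (hxy : x + y = 1)
    (h : Good A rsK rsL g) (h' : Good A rsK rsL g') :
    Good A rsK rsL (fun p q => x * g p q + y * g' p q) := by
  refine ⟨h.ranged.convexComb hx hy hxy h'.ranged, h.modI.convexComb hx hy hxy h'.modI, ?_,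
    fun p hp q hq => by rw [h.balanced p hp q hq, h'.balanced p hp q hq]⟩
  have := h.modII.convexComb hx hy hxy h'.modII
  convert this using 3
  simp only [MertensZamir.negSwap]; ring

lemma vexII_le_self (hg : Ranged g) {p : K → ℝ} {q : L → ℝ} (hp : p ∈ stdSimplex ℝ K)
    (hq : q ∈ stdSimplex ℝ L) : vexII g p q ≤ g p q := by
  have := self_le_cavI hg.negSwap hq hp
  rw [vexII_eq]
  simp only [negSwap] at *
  linarith

lemma vexII_le_add (hg : Ranged g) {c : ℝ}
    (H : ∀ p ∈ stdSimplex ℝ K, ∀ q ∈ stdSimplex ℝ L, g p q ≤ g' p q + c)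
    {p : K → ℝ} {q : L → ℝ} (hp : p ∈ stdSimplex ℝ K) (hq : q ∈ stdSimplex ℝ L) :
    vexII g p q ≤ vexII g' p q + c := by
  have := cavI_le_add (g := negSwap g') (g' := negSwap g) hg.negSwap (c := c)
    (fun q hq p hp => by simp only [negSwap]; linarith [H p hp q hq]) hq hp
  rw [vexII_eq, vexII_eq]
  simp only [negSwap] at *
  linarith

/-- One step of the discounted recursion. -/
noncomputable def stepOp (f : (K → ℝ) → (L → ℝ) → ℝ) (x : ℝ) (u : (K → ℝ) → (L → ℝ) → ℝ) :
    (K → ℝ) → (L → ℝ) → ℝ :=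
  cavI (vexII (fun p q => x * f p q + (1 - x) * u p q))

lemma Good.stepOp (hA : ∀ a ∈ A, 0 ≤ a.2) {x : ℝ} (hx0 : 0 ≤ x) (hx1 : x ≤ 1)
    (hf : Good A rsK rsL f) (hg : Good A rsK rsL g) : Good A rsK rsL (stepOp f x g) :=
  ((hf.convexComb hx0 (sub_nonneg.2 hx1) (by ring) hg).vexII hA).cavI hA

lemma stepOp_le_add {x c : ℝ} (hx0 : 0 ≤ x) (hx1 : x ≤ 1) (hf : Ranged f) (hg : Ranged g)
    (hg' : Ranged g')
    (H : ∀ p ∈ stdSimplex ℝ K, ∀ q ∈ stdSimplex ℝ L, g p q ≤ g' p q + c)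
    {p : K → ℝ} {q : L → ℝ} (hp : p ∈ stdSimplex ℝ K) (hq : q ∈ stdSimplex ℝ L) :
    stepOp f x g p q ≤ stepOp f x g' p q + (1 - x) * c := by
  have hx1' := sub_nonneg.2 hx1
  refine cavI_le_add ?_ (fun p hp q hq => vexII_le_add ?_ (fun p hp q hq => ?_) hp hq) hp hq
  · rw [vexII_eq]
    exact (ranged_cavI (hf.convexComb hx0 hx1' (by ring) hg').negSwap).negSwap
  · exact hf.convexComb hx0 hx1' (by ring) hg
  · linarith [mul_le_mul_of_nonneg_left (H p hp q hq) hx1']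

lemma stepOp_iterate (hA : ∀ a ∈ A, 0 ≤ a.2) {x : ℝ} (hx0 : 0 ≤ x) (hx1 : x ≤ 1)
    (hf : Good A rsK rsL f) (k : ℕ) :
    Good A rsK rsL ((stepOp f x)^[k] f) ∧ ∀ p ∈ stdSimplex ℝ K, ∀ q ∈ stdSimplex ℝ L,
      |(stepOp f x)^[k + 1] f p q - (stepOp f x)^[k] f p q| ≤ (1 - x) ^ k * 2 := by
  induction k with
  | zero =>
    refine ⟨hf, fun p hp q hq => ?_⟩
    have h1 := (hf.stepOp hA hx0 hx1 hf).ranged p hp q hq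
    have h2 := hf.ranged p hp q hq
    simp only [Function.iterate_succ, Function.iterate_zero, Function.comp, id, Set.mem_Icc] at *
    rw [abs_le]; constructor <;> linarith [h1.1, h1.2, h2.1, h2.2]
  | succ k ih =>
    obtain ⟨hk, hd⟩ := ih
    rw [Function.iterate_succ_apply'] at hd
    rw [Function.iterate_succ_apply' _ (k + 1), Function.iterate_succ_apply' _ k]
    have hk1 : Good A rsK rsL (stepOp f x ((stepOp f x)^[k] f)) :=
      hf.stepOp hA hx0 hx1 hk
    refine ⟨hk1, fun p hp q hq => ?_⟩
    have h1 := stepOp_le_add (c := (1 - x) ^ k * 2) hx0 hx1 hf.ranged hk.ranged hk1.ranged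
      (fun p hp q hq => by linarith [(abs_le.1 (hd p hp q hq)).1]) hp hq
    have h2 := stepOp_le_add (c := (1 - x) ^ k * 2) hx0 hx1 hf.ranged hk1.ranged hk.ranged
      (fun p hp q hq => by linarith [(abs_le.1 (hd p hp q hq)).2]) hp hq
    rw [abs_le, pow_succ]
    constructor <;> linarith

/-- Splitting an average of `f` and an almost fixed concave function controls each separately. -/
lemma sub_of_discounted {x : ℝ} (hx0 : 0 < x) (hx1 : x ≤ 1) (hf : Ranged f) (hg : Ranged g)
    (hc : IConcave g)
    (hd : ∀ p ∈ stdSimplex ℝ K, ∀ q ∈ stdSimplex ℝ L, g' p q ≤ g p q + x ^ 2)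
    (H : ∀ p ∈ stdSimplex ℝ K, ∀ q ∈ stdSimplex ℝ L,
      g p q ≤ cavI (fun p q => x * f p q + (1 - x) * g' p q) p q) :
    Sub (4 * x) g f := by
  intro p hp q hq
  obtain ⟨n, α, ps, h, e⟩ :=
    exists_split_cavI hp (fun p q => x * f p q + (1 - x) * g' p q) q (pow_pos hx0 2)
  have h1 : ∑ m, α m * (x * f (ps m) q + (1 - x) * g' (ps m) q)
      ≤ x * ∑ m, α m * f (ps m) q + (1 - x) * ∑ m, α m * g (ps m) q + x ^ 2 := by
    calc _ ≤ ∑ m, α m * (x * f (ps m) q + (1 - x) * g (ps m) q + x ^ 2) := by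
          refine h.sum_le_sum fun m => ?_
          have := mul_le_mul_of_nonneg_left (hd _ (h.mem m) q hq) (sub_nonneg.2 hx1)
          nlinarith [pow_pos hx0 2]
      _ = _ := by
          simp only [mul_add _ _ (x ^ 2), Finset.sum_add_distrib, h.sum_const]
          simp only [mul_add, Finset.sum_add_distrib, Finset.mul_sum]
          congr 2 <;> exact Finset.sum_congr rfl fun m _ => by ring
  have h2 := H p hp q hq
  have h3 := hc.sum_le h hq
  have h4 : ∑ m, α m * f (ps m) q ≤ 1 := h.sum_le fun m => (hf _ (h.mem m) q hq).2
  have h5 : -1 ≤ ∑ m, α m * g (ps m) q := by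
    refine (h.sum_const (-1)).symm.trans_le (h.sum_le_sum fun m => (hg _ (h.mem m) q hq).1)
  set F := ∑ m, α m * f (ps m) q
  set G := ∑ m, α m * g (ps m) q
  have h6 : g p q ≤ x * F + (1 - x) * G + 2 * x ^ 2 := by linarith
  refine ⟨n, α, ps, h, ?_, ?_⟩
  · change g p q - 4 * x ≤ G
    nlinarith
  · change g p q - 4 * x ≤ F
    have h7 : x * (g p q) ≤ x * (F + 2 * x) := by nlinarith
    have := le_of_mul_le_mul_left h7 hx0
    linarith

lemma exists_approx (hA : ∀ a ∈ A, 0 ≤ a.2) (hf : Good A rsK rsL f) {η : ℝ} (hη : 0 < η) :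
    ∃ v, Good A rsK rsL v ∧ IConcave v ∧ IConcave (negSwap v) ∧ Sub η v f ∧
      Sub η (negSwap v) (negSwap f) := by
  obtain ⟨x, hx0, hx1, hxη⟩ : ∃ x : ℝ, 0 < x ∧ x ≤ 1 ∧ 4 * x ≤ η :=
    ⟨min 1 (η / 4), by positivity, min_le_left _ _, by linarith [min_le_right 1 (η / 4)]⟩
  have hx1' := sub_nonneg.2 hx1
  obtain ⟨k, hk⟩ := exists_pow_lt_of_lt_one (show (0 : ℝ) < x ^ 2 / 2 by positivity)
    (show 1 - x < 1 by linarith)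
  obtain ⟨hu, hd⟩ := stepOp_iterate hA hx0.le hx1 hf k
  have hv : Good A rsK rsL (stepOp f x ((stepOp f x)^[k] f)) := hf.stepOp hA hx0.le hx1 hu
  rw [Function.iterate_succ_apply'] at hd
  set u := (stepOp f x)^[k] f
  set v := stepOp f x u with hvdef
  have hm : Good A rsK rsL (fun p q => x * f p q + (1 - x) * u p q) :=
    hf.convexComb hx0.le hx1' (by ring) hu
  have hvex := hm.vexII hA
  have hc : IConcave v := iConcave_cavI hvex.ranged
  have hc' : IConcave (negSwap v) := by
    refine iConvex_cavI hvex.ranged ?_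
    rw [vexII_eq, negSwap_negSwap]
    exact iConcave_cavI hm.negSwap.ranged
  refine ⟨v, hv, hc, hc', ?_, ?_⟩
  · refine Sub.mono hxη ?_
    refine sub_of_discounted (g' := u) hx0 hx1 hf.ranged hv.ranged hc ?_ ?_
    · intro p hp q hq
      linarith [(abs_le.1 (hd p hp q hq)).1]
    · intro p hp q hq
      have := cavI_le_add (g := vexII _) (c := 0) hm.ranged
        (fun p hp q hq => by linarith [vexII_le_self hm.ranged hp hq]) hp hq
      rw [add_zero] at this
      exact this
  · refine Sub.mono hxη ?_
    refine sub_of_discounted (g' := negSwap u) hx0 hx1 hf.negSwap.ranged hv.negSwap.ranged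
      hc' ?_ ?_
    · intro q hq p hp
      simp only [negSwap]
      linarith [(abs_le.1 (hd p hp q hq)).2]
    · intro q hq p hp
      have h1 := self_le_cavI hvex.ranged hp hq
      change _ ≤ v p q at h1
      rw [vexII_eq] at h1
      have h2 : negSwap (fun p q => x * f p q + (1 - x) * u p q)
          = fun q p => x * negSwap f q p + (1 - x) * negSwap u q p := by
        funext q p; simp only [negSwap]; ring
      rw [← h2]
      simp only [negSwap] at h1 ⊢
      linarith

end GoodFunctions

section Comparison

variable {K L : Type*} [Fintype K] [Fintype L] {A : Set (ℝ × ℝ)}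
  {f : (K → ℝ) → (L → ℝ) → ℝ}

/-- The squared Euclidean norm, a strictly convex function on the simplex. -/
def sqNorm {S : Type*} [Fintype S] (p : S → ℝ) : ℝ := ∑ k, p k ^ 2

lemma sqNorm_nonneg (p : K → ℝ) : 0 ≤ sqNorm p := Finset.sum_nonneg fun _ _ => sq_nonneg _

lemma sqNorm_le_one {p : K → ℝ} (hp : p ∈ stdSimplex ℝ K) : sqNorm p ≤ 1 := by
  rw [← hp.2]
  refine Finset.sum_le_sum fun k _ => ?_
  have h1 : p k ≤ 1 := by
    rw [← hp.2]; exact Finset.single_le_sum (fun j _ => hp.1 j) (Finset.mem_univ k)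
  nlinarith [hp.1 k]

lemma IsSplit.sum_sqNorm {ι : Type*} [Fintype ι] {α : ι → ℝ} {ps : ι → K → ℝ} {p : K → ℝ}
    (h : IsSplit α ps p) :
    ∑ m, α m * sqNorm (ps m) = sqNorm p + ∑ m, α m * sqNorm (ps m - p) := by
  simp only [sqNorm, Finset.mul_sum]
  rw [Finset.sum_comm, Finset.sum_comm (s := Finset.univ (α := ι)) (f := fun m k => α m * (ps m - p) k ^ 2),
    ← Finset.sum_add_distrib]
  refine Finset.sum_congr rfl fun k _ => ?_
  have h1 : ∑ m, α m * (ps m - p) k ^ 2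
      = ∑ m, α m * ps m k ^ 2 - 2 * p k * ∑ m, α m * ps m k + ∑ m, α m * p k ^ 2 := by
    rw [Finset.mul_sum, ← Finset.sum_sub_distrib, ← Finset.sum_add_distrib]
    exact Finset.sum_congr rfl fun m _ => by simp only [Pi.sub_apply]; ring
  rw [h1, h.bary_apply, h.sum_const]; ring

lemma dist1_le_sqNorm {τ : ℝ} (hτ : 0 < τ) (p p' : K → ℝ) :
    dist1 p p' ≤ Fintype.card K * τ + sqNorm (p - p') / τ := by
  have : dist1 p p' ≤ ∑ k, (τ + (p - p') k ^ 2 / τ) := by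
    refine Finset.sum_le_sum fun k _ => ?_
    rw [Pi.sub_apply, ← sq_abs, ← sub_nonneg]
    have : τ + |p k - p' k| ^ 2 / τ - |p k - p' k|
        = ((|p k - p' k| - τ) ^ 2 + τ * |p k - p' k|) / τ := by field_simp; ring
    rw [this]; positivity
  simpa [Finset.sum_add_distrib, sqNorm, Finset.sum_div] using this

/-- At an almost maximizer of a strictly convex perturbation of `v₁ - v₂`, the splitting of
player I is almost trivial, hence `v₁` is almost below `f`. -/
lemma le_at_max (hA : ∀ a ∈ A, 0 ≤ a.2) (hAs : ∀ ε > 0, ∃ C, (ε, C) ∈ A) (hm : ModI A f)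
    {ε δ : ℝ} (hε : 0 < ε) (hδ : 0 < δ) :
    ∃ η₀ > 0, ∀ η, η ≤ η₀ → ∀ v₁ v₂ : (K → ℝ) → (L → ℝ) → ℝ, IConcave v₂ → Sub η v₁ f →
      ∀ p ∈ stdSimplex ℝ K, ∀ q ∈ stdSimplex ℝ L,
      (∀ p' ∈ stdSimplex ℝ K, v₁ p' q - v₂ p' q + δ * sqNorm p' ≤
        v₁ p q - v₂ p q + δ * sqNorm p + η) → v₁ p q ≤ f p q + ε := by
  obtain ⟨C, hC⟩ := hAs (ε / 3) (by positivity)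
  have hC0 : 0 ≤ C := hA _ hC
  set N : ℝ := Fintype.card K + 2 with hN
  have hN0 : 0 < N := by positivity
  set τ : ℝ := ε / (3 * (C * N + 1)) with hτ
  have hτ0 : 0 < τ := by positivity
  refine ⟨min (ε / 3) (δ * τ ^ 2), by positivity, ?_⟩
  intro η hη v₁ v₂ hc hs p hp q hq hmax
  obtain ⟨n, α, ps, h, e1, e2⟩ := hs p hp q hq
  have hη1 := hη.trans (min_le_left _ _)
  have hη2 := hη.trans (min_le_right _ _)
  have i1 := h.sum_le_sum fun m => hmax _ (h.mem m)
  rw [h.sum_const] at i1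
  have i2 : ∑ m, α m * (v₁ (ps m) q - v₂ (ps m) q + δ * sqNorm (ps m))
      = ∑ m, α m * v₁ (ps m) q - ∑ m, α m * v₂ (ps m) q
        + δ * ∑ m, α m * sqNorm (ps m) := by
    rw [Finset.mul_sum, ← Finset.sum_sub_distrib, ← Finset.sum_add_distrib]
    exact Finset.sum_congr rfl fun m _ => by ring
  have i3 := hc.sum_le h hq
  rw [i2, h.sum_sqNorm] at i1
  have i4 : δ * ∑ m, α m * sqNorm (ps m - p) ≤ δ * (2 * τ ^ 2) := by linarith
  have i5 := le_of_mul_le_mul_left i4 hδ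
  have i6 : ∑ m, α m * dist1 (ps m) p ≤ N * τ := by
    calc ∑ m, α m * dist1 (ps m) p
        ≤ ∑ m, α m * (Fintype.card K * τ + sqNorm (ps m - p) / τ) :=
          h.sum_le_sum fun m => dist1_le_sqNorm hτ0 _ _
      _ = Fintype.card K * τ + (∑ m, α m * sqNorm (ps m - p)) / τ := by
          simp only [mul_add, Finset.sum_add_distrib, h.sum_const, Finset.sum_div, mul_div_assoc]
      _ ≤ Fintype.card K * τ + 2 * τ := by
          gcongr
          rw [div_le_iff₀ hτ0]
          linarith
      _ = N * τ := by rw [hN]; ring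
  have i7 : ∑ m, α m * f (ps m) q ≤ f p q + (ε / 3 + C * ∑ m, α m * dist1 (ps m) p) := by
    calc ∑ m, α m * f (ps m) q ≤ ∑ m, α m * (f p q + (ε / 3 + C * dist1 (ps m) p)) :=
          h.sum_le_sum fun m => by linarith [hm _ hC _ (h.mem m) p hp q hq]
      _ = _ := by
          simp only [mul_add, Finset.sum_add_distrib, h.sum_const, Finset.mul_sum]
          congr 2
          exact Finset.sum_congr rfl fun m _ => by ring
  have i8 : C * (N * τ) ≤ ε / 3 := by
    have : (C * N + 1) * τ = ε / 3 := by rw [hτ]; field_simp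
    nlinarith
  linarith [mul_le_mul_of_nonneg_left i6 hC0]

lemma exists_almost_max (G : (K → ℝ) → (L → ℝ) → ℝ) {c : ℝ}
    (hG : ∀ p ∈ stdSimplex ℝ K, ∀ q ∈ stdSimplex ℝ L, G p q ≤ c)
    {p₀ : K → ℝ} {q₀ : L → ℝ} (hp₀ : p₀ ∈ stdSimplex ℝ K) (hq₀ : q₀ ∈ stdSimplex ℝ L)
    {η : ℝ} (hη : 0 < η) :
    ∃ p ∈ stdSimplex ℝ K, ∃ q ∈ stdSimplex ℝ L,
      ∀ p' ∈ stdSimplex ℝ K, ∀ q' ∈ stdSimplex ℝ L, G p' q' ≤ G p q + η := by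
  set S := {x | ∃ p ∈ stdSimplex ℝ K, ∃ q ∈ stdSimplex ℝ L, G p q = x} with hS
  have hb : BddAbove S := ⟨c, by rintro _ ⟨p, hp, q, hq, rfl⟩; exact hG p hp q hq⟩
  obtain ⟨_, ⟨p, hp, q, hq, rfl⟩, h⟩ :=
    exists_lt_of_lt_csSup (s := S) ⟨_, p₀, hp₀, q₀, hq₀, rfl⟩ (sub_lt_self (sSup S) hη)
  refine ⟨p, hp, q, hq, fun p' hp' q' hq' => ?_⟩
  linarith [le_csSup hb ⟨p', hp', q', hq', rfl⟩]

/-- Approximate comparison principle. -/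
lemma comparison (hA : ∀ a ∈ A, 0 ≤ a.2) (hAs : ∀ ε > 0, ∃ C, (ε, C) ∈ A) (hm : ModI A f)
    (hm' : ModI A (negSwap f)) {ε : ℝ} (hε : 0 < ε) :
    ∃ η > 0, ∀ v₁ v₂ : (K → ℝ) → (L → ℝ) → ℝ, Ranged v₁ → Ranged v₂ → IConcave (negSwap v₁) →
      IConcave v₂ → Sub η v₁ f → Sub η (negSwap v₂) (negSwap f) →
      ∀ p ∈ stdSimplex ℝ K, ∀ q ∈ stdSimplex ℝ L, v₁ p q ≤ v₂ p q + ε := by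
  have hε5 : 0 < ε / 5 := by positivity
  obtain ⟨η₁, hη₁, H₁⟩ := le_at_max (L := L) hA hAs hm hε5 hε5
  obtain ⟨η₂, hη₂, H₂⟩ := le_at_max (L := K) hA hAs hm' hε5 hε5
  refine ⟨min (ε / 5) (min η₁ η₂), by positivity, ?_⟩
  intro v₁ v₂ r₁ r₂ c₁ c₂ s₁ s₂ p' hp' q' hq'
  set η := min (ε / 5) (min η₁ η₂) with hη
  have hη0 : 0 < η := by positivity
  have e1 : η ≤ ε / 5 := min_le_left _ _
  have e2 : η ≤ η₁ := (min_le_right _ _).trans (min_le_left _ _)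
  have e3 : η ≤ η₂ := (min_le_right _ _).trans (min_le_right _ _)
  obtain ⟨p, hp, q, hq, hmax⟩ := exists_almost_max (c := 2 + 2 * (ε / 5))
    (fun p q => v₁ p q - v₂ p q + ε / 5 * (sqNorm p + sqNorm q))
    (fun p hp q hq => by
      have := sqNorm_le_one hp
      have := sqNorm_le_one hq
      have := (r₁ p hp q hq).2
      have := (r₂ p hp q hq).1
      nlinarith) hp' hq' hη0
  have j1 := H₁ η e2 v₁ v₂ c₂ s₁ p hp q hq fun x hx => by linarith [hmax x hx q hq]
  have j2 := H₂ η e3 (negSwap v₂) (negSwap v₁) c₁ s₂ q hq p hp fun x hx => by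
    simp only [negSwap]; linarith [hmax p hp x hx]
  simp only [negSwap] at j2
  have j3 := hmax p' hp' q' hq'
  have := sqNorm_le_one hp
  have := sqNorm_le_one hq
  have := sqNorm_nonneg p'
  have := sqNorm_nonneg q'
  nlinarith

/-- A function which is almost `f`-dominated along splittings is below every concave majorant of
`min w f`. -/
lemma le_of_sub (hA : ∀ a ∈ A, 0 ≤ a.2) (hAs : ∀ ε > 0, ∃ C, (ε, C) ∈ A) (hm : ModI A f)
    {w h : (K → ℝ) → (L → ℝ) → ℝ} (hw : Ranged w) (hh : Ranged h) (hc : IConcave h)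
    (hs : ∀ η > 0, Sub η w f)
    (H : ∀ p ∈ stdSimplex ℝ K, ∀ q ∈ stdSimplex ℝ L, min (w p q) (f p q) ≤ h p q)
    {p' : K → ℝ} {q' : L → ℝ} (hp' : p' ∈ stdSimplex ℝ K) (hq' : q' ∈ stdSimplex ℝ L) :
    w p' q' ≤ h p' q' := by
  refine le_of_forall_pos_le_add fun ε hε => ?_
  have hε5 : 0 < ε / 5 := by positivity
  obtain ⟨η₁, hη₁, H₁⟩ := le_at_max (L := L) hA hAs hm hε5 hε5
  set η := min (ε / 5) η₁ with hη
  have hη0 : 0 < η := by positivity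
  have e1 : η ≤ ε / 5 := min_le_left _ _
  obtain ⟨p, hp, q, hq, hmax⟩ := exists_almost_max (c := 2 + ε / 5)
    (fun p q => w p q - h p q + ε / 5 * sqNorm p)
    (fun p hp q hq => by
      have := sqNorm_le_one hp
      have := (hw p hp q hq).2
      have := (hh p hp q hq).1
      nlinarith) hp' hq' hη0
  have j1 := H₁ η (min_le_right _ _) w h hc (hs η hη0) p hp q hq fun x hx => hmax x hx q hq
  have j2 := H p hp q hq
  have j3 := hmax p' hp' q' hq'
  have := sqNorm_le_one hp
  have := sqNorm_nonneg p'
  have j4 : w p q - ε / 5 ≤ min (w p q) (f p q) := le_min (by linarith) (by linarith)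
  nlinarith

end Comparison

lemma vexII_max_eq {K L : Type*} [Fintype L] {f w : (K → ℝ) → (L → ℝ) → ℝ}
    (p : K → ℝ) (q : L → ℝ) :
    vexII (fun p' q' => max (w p' q') (f p' q')) p q
      = - cavI (fun q' p' => min (negSwap w q' p') (negSwap f q' p')) q p := by
  rw [vexII_eq]
  simp only [negSwap, min_neg_neg]
  rfl

section Solution

variable {K L : Type*} [Fintype K] [Fintype L] {RK RL : ℕ} {A : Set (ℝ × ℝ)}
  {rsK : RecStruct K RK} {rsL : RecStruct L RL} {f w : (K → ℝ) → (L → ℝ) → ℝ}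

/-- A regular balanced saddle function along which both players can split in a way compatible
with the obstacle `f`. -/
structure IsSolution (A : Set (ℝ × ℝ)) (rsK : RecStruct K RK) (rsL : RecStruct L RL)
    (f w : (K → ℝ) → (L → ℝ) → ℝ) : Prop where
  good : Good A rsK rsL w
  concave : IConcave w
  convex : IConcave (negSwap w)
  sub : ∀ η > 0, Sub η w f
  super : ∀ η > 0, Sub η (negSwap w) (negSwap f)

lemma IsSolution.negSwap (h : IsSolution A rsK rsL f w) :
    IsSolution A rsL rsK (negSwap f) (negSwap w) :=
  ⟨h.good.negSwap, h.convex, by simpa using h.concave, h.super, by simpa using h.sub⟩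

lemma modI_of_approx (H : ∀ ε > 0, ∃ v, ModI A v ∧
    ∀ p ∈ stdSimplex ℝ K, ∀ q ∈ stdSimplex ℝ L, |v p q - w p q| ≤ ε) : ModI A w := by
  intro a ha p hp p' hp' q hq
  refine le_of_forall_pos_le_add fun ε hε => ?_
  obtain ⟨v, hv, hd⟩ := H (ε / 2) (by positivity)
  linarith [hv a ha p hp p' hp' q hq, (abs_le.1 (hd p hp q hq)).1,
    (abs_le.1 (hd p' hp' q hq)).2]

lemma iConcave_of_approx (H : ∀ ε > 0, ∃ v, IConcave v ∧
    ∀ p ∈ stdSimplex ℝ K, ∀ q ∈ stdSimplex ℝ L, |v p q - w p q| ≤ ε) : IConcave w := by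
  intro q hq
  refine ⟨convex_stdSimplex ℝ K, ?_⟩
  intro p hp p' hp' a b ha hb hab
  refine le_of_forall_pos_le_add fun ε hε => ?_
  obtain ⟨v, hv, hd⟩ := H (ε / 2) (by positivity)
  have h1 := (hv q hq).2 hp hp' ha hb hab
  have h2 := mul_le_mul_of_nonneg_left (abs_le.1 (hd p hp q hq)).1 ha
  have h3 := mul_le_mul_of_nonneg_left (abs_le.1 (hd p' hp' q hq)).1 hb
  have h4 := (abs_le.1 (hd _ (convex_stdSimplex ℝ K hp hp' ha hb hab) q hq)).2
  have h5 : a * (ε / 2) + b * (ε / 2) = ε / 2 := by rw [← add_mul, hab, one_mul]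
  simp only [smul_eq_mul] at *
  linarith

lemma sub_of_approx (H : ∀ ε > 0, ∃ v, Sub ε v f ∧
    ∀ p ∈ stdSimplex ℝ K, ∀ q ∈ stdSimplex ℝ L, |v p q - w p q| ≤ ε) {η : ℝ} (hη : 0 < η) :
    Sub η w f := by
  intro p hp q hq
  obtain ⟨v, hv, hd⟩ := H (η / 3) (by positivity)
  obtain ⟨n, α, ps, h, h1, h2⟩ := hv p hp q hq
  have h3 := (abs_le.1 (hd p hp q hq)).1
  refine ⟨n, α, ps, h, ?_, by linarith⟩
  have : ∑ m, α m * v (ps m) q ≤ ∑ m, α m * w (ps m) q + η / 3 := by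
    calc ∑ m, α m * v (ps m) q ≤ ∑ m, α m * (w (ps m) q + η / 3) :=
          h.sum_le_sum fun m => by linarith [(abs_le.1 (hd _ (h.mem m) q hq)).2]
      _ = _ := by simp only [mul_add, Finset.sum_add_distrib, h.sum_const]
  linarith

lemma isSolution_of_approx (H : ∀ ε > 0, ∃ v, (Good A rsK rsL v ∧ IConcave v ∧
      IConcave (negSwap v) ∧ Sub ε v f ∧ Sub ε (negSwap v) (negSwap f)) ∧
      ∀ p ∈ stdSimplex ℝ K, ∀ q ∈ stdSimplex ℝ L, |v p q - w p q| ≤ ε) :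
    IsSolution A rsK rsL f w := by
  have hsw : ∀ {v : (K → ℝ) → (L → ℝ) → ℝ} {ε : ℝ},
      (∀ p ∈ stdSimplex ℝ K, ∀ q ∈ stdSimplex ℝ L, |v p q - w p q| ≤ ε) →
      ∀ q ∈ stdSimplex ℝ L, ∀ p ∈ stdSimplex ℝ K,
        |MertensZamir.negSwap v q p - MertensZamir.negSwap w q p| ≤ ε := by
    intro v ε hd q hq p hp
    simp only [MertensZamir.negSwap]
    rw [neg_sub_neg, abs_sub_comm]
    exact hd p hp q hq
  refine ⟨⟨fun p hp q hq => ⟨?_, ?_⟩, ?_, ?_, fun p hp q hq => ?_⟩, ?_, ?_, fun η hη => ?_,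
    fun η hη => ?_⟩
  · refine le_of_forall_pos_le_add fun ε hε => ?_
    obtain ⟨v, ⟨hv, -⟩, hd⟩ := H ε hε
    linarith [(hv.ranged p hp q hq).1, (abs_le.1 (hd p hp q hq)).2]
  · refine le_of_forall_pos_le_add fun ε hε => ?_
    obtain ⟨v, ⟨hv, -⟩, hd⟩ := H ε hε
    linarith [(hv.ranged p hp q hq).2, (abs_le.1 (hd p hp q hq)).1]
  · exact modI_of_approx fun ε hε => (H ε hε).imp fun v h => ⟨h.1.1.modI, h.2⟩
  · refine modI_of_approx fun ε hε => ?_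
    obtain ⟨v, h, hd⟩ := H ε hε
    exact ⟨_, h.1.modII, hsw hd⟩
  · refine eq_of_abs_sub_le_all fun ε hε => ?_
    obtain ⟨v, ⟨hv, -⟩, hd⟩ := H (ε / 2) (by positivity)
    have h1 := abs_le.1 (hd p hp q hq)
    have h2 := abs_le.1 (hd _ (vecMulF_mem hp (Bmat_mem rsK)) _ (vecMulF_mem hq (Bmat_mem rsL)))
    rw [← hv.balanced p hp q hq] at h2
    rw [abs_le]
    constructor <;> linarith [h1.1, h1.2, h2.1, h2.2]
  · exact iConcave_of_approx fun ε hε => (H ε hε).imp fun v h => ⟨h.1.2.1, h.2⟩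
  · refine iConcave_of_approx fun ε hε => ?_
    obtain ⟨v, h, hd⟩ := H ε hε
    exact ⟨_, h.2.2.1, hsw hd⟩
  · exact sub_of_approx (fun ε hε => (H ε hε).imp fun v h => ⟨h.1.2.2.2.1, h.2⟩) hη
  · refine sub_of_approx (fun ε hε => ?_) hη
    obtain ⟨v, h, hd⟩ := H ε hε
    exact ⟨_, h.2.2.2.2, hsw hd⟩

lemma exists_isSolution (hA : ∀ a ∈ A, 0 ≤ a.2) (hAs : ∀ ε > 0, ∃ C, (ε, C) ∈ A)
    (hf : Good A rsK rsL f) : ∃ w, IsSolution A rsK rsL f w := by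
  have hpos : ∀ n : ℕ, (0 : ℝ) < 1 / (n + 1) := fun n => Nat.one_div_pos_of_nat
  choose v hv using fun n : ℕ => exists_approx hA hf (hpos n)
  have hsmall : ∀ η > (0 : ℝ), ∃ N : ℕ, ∀ n ≥ N, (1 : ℝ) / (n + 1) ≤ η := by
    intro η hη
    obtain ⟨N, hN⟩ := exists_nat_one_div_lt hη
    exact ⟨N, fun n hn => (Nat.one_div_le_one_div hn).trans hN.le⟩
  have hcau : ∀ ε > (0 : ℝ), ∃ N : ℕ, ∀ n ≥ N, ∀ m ≥ N, ∀ p ∈ stdSimplex ℝ K,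
      ∀ q ∈ stdSimplex ℝ L, v n p q ≤ v m p q + ε := by
    intro ε hε
    obtain ⟨η, hη, H⟩ := comparison hA hAs hf.modI hf.modII hε
    obtain ⟨N, hN⟩ := hsmall η hη
    refine ⟨N, fun n hn m hm => ?_⟩
    obtain ⟨g1, -, c1, s1, -⟩ := hv n
    obtain ⟨g2, c2, -, -, s2⟩ := hv m
    exact H _ _ g1.ranged g2.ranged c1 c2 (s1.mono (hN n hn)) (s2.mono (hN m hm))
  have hlim : ∀ p q, ∃ l : ℝ, p ∈ stdSimplex ℝ K → q ∈ stdSimplex ℝ L →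
      Filter.Tendsto (fun n => v n p q) Filter.atTop (nhds l) := by
    intro p q
    by_cases h : p ∈ stdSimplex ℝ K ∧ q ∈ stdSimplex ℝ L
    · have : CauchySeq fun n => v n p q := by
        rw [Metric.cauchySeq_iff]
        intro ε hε
        obtain ⟨N, hN⟩ := hcau (ε / 2) (by positivity)
        refine ⟨N, fun n hn m hm => ?_⟩
        have h1 := hN n hn m hm p h.1 q h.2
        have h2 := hN m hm n hn p h.1 q h.2
        rw [Real.dist_eq, abs_lt]
        constructor <;> linarith
      obtain ⟨l, hl⟩ := cauchySeq_tendsto_of_complete this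
      exact ⟨l, fun _ _ => hl⟩
    · exact ⟨0, fun h1 h2 => absurd ⟨h1, h2⟩ h⟩
  choose w hw using hlim
  refine ⟨w, isSolution_of_approx fun ε hε => ?_⟩
  obtain ⟨N₁, hN₁⟩ := hcau ε hε
  obtain ⟨N₂, hN₂⟩ := hsmall ε hε
  obtain ⟨g, c1, c2, s1, s2⟩ := hv (max N₁ N₂)
  refine ⟨v (max N₁ N₂), ⟨g, c1, c2, s1.mono (hN₂ _ (le_max_right _ _)),
    s2.mono (hN₂ _ (le_max_right _ _))⟩, fun p hp q hq => ?_⟩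
  have h1 := le_of_tendsto (hw p q hp hq) (Filter.eventually_atTop.2 ⟨N₁, fun n hn =>
    hN₁ n hn (max N₁ N₂) (le_max_left _ _) p hp q hq⟩)
  have h2 := ge_of_tendsto (hw p q hp hq) (Filter.eventually_atTop.2 ⟨N₁, fun n hn =>
    sub_le_iff_le_add.2 (hN₁ (max N₁ N₂) (le_max_left _ _) n hn p hp q hq)⟩)
  rw [abs_le]
  constructor <;> linarith

lemma continuous_dist1 (p' : K → ℝ) : Continuous fun p : K → ℝ => dist1 p p' := by
  unfold dist1; fun_prop

lemma Good.memC (hAs : ∀ ε > 0, ∃ C, (ε, C) ∈ A) (hw : Good A rsK rsL w) : MemC w := by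
  refine ⟨?_, hw.ranged⟩
  rintro ⟨p, q⟩ ⟨hp, hq⟩
  rw [ContinuousWithinAt, Metric.tendsto_nhds]
  intro ε hε
  obtain ⟨C, hC⟩ := hAs (ε / 3) (by positivity)
  have hcont : Continuous fun x : (K → ℝ) × (L → ℝ) =>
      2 * (ε / 3) + C * (dist1 x.1 p + dist1 x.2 q) :=
    continuous_const.add (continuous_const.mul
      (((continuous_dist1 p).comp continuous_fst).add ((continuous_dist1 q).comp continuous_snd)))
  have hlt : 2 * (ε / 3) + C * (dist1 p p + dist1 q q) < ε := by
    simp only [dist1, sub_self, abs_zero, Finset.sum_const_zero]; linarith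
  have hev := nhdsWithin_le_nhds (s := stdSimplex ℝ K ×ˢ stdSimplex ℝ L)
    (hcont.continuousAt.eventually_lt (x₀ := (p, q)) continuousAt_const hlt)
  filter_upwards [hev, self_mem_nhdsWithin] with x hx hxm
  obtain ⟨hx1, hx2⟩ := hxm
  have a1 := hw.modI _ hC _ hx1 p hp _ hx2
  have a2 := hw.modI _ hC p hp _ hx1 _ hx2
  have a3 := hw.modII _ hC _ hx2 q hq p hp
  have a4 := hw.modII _ hC q hq _ hx2 p hp
  rw [dist1_comm p] at a2
  rw [dist1_comm q] at a4
  simp only [MertensZamir.negSwap] at a1 a2 a3 a4 hx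
  rw [Real.dist_eq, abs_lt]
  constructor <;> linarith

lemma ranged_min {g g' : (K → ℝ) → (L → ℝ) → ℝ} (h : Ranged g) (h' : Ranged g') :
    Ranged (fun p q => min (g p q) (g' p q)) :=
  fun p hp q hq => ⟨le_min (h p hp q hq).1 (h' p hp q hq).1,
    (min_le_left _ _).trans (h p hp q hq).2⟩

lemma iConcave_negSwap_iff : IConcave (negSwap w) ↔
    ∀ p ∈ stdSimplex ℝ K, ConvexOn ℝ (stdSimplex ℝ L) (fun q => w p q) := by
  refine forall₂_congr fun p _ => ?_
  exact neg_concaveOn_iff (f := fun q => w p q)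

lemma IsSolution.mem_Cminus (hA : ∀ a ∈ A, 0 ≤ a.2) (hAs : ∀ ε > 0, ∃ C, (ε, C) ∈ A)
    (hf : Good A rsK rsL f) (h : IsSolution A rsK rsL f w) : memCminus f w := by
  have hr := ranged_min h.good.ranged hf.ranged
  exact ⟨h.good.memC hAs, iConcave_negSwap_iff.1 h.convex, fun p hp q hq =>
    le_of_sub hA hAs hf.modI h.good.ranged (ranged_cavI hr) (iConcave_cavI hr) h.sub
      (fun p hp q hq => self_le_cavI hr hp hq) hp hq⟩

lemma sub_of_memCminus (h : memCminus f w) {η : ℝ} (hη : 0 < η) : Sub η w f := by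
  intro p hp q hq
  obtain ⟨n, α, ps, hs, e⟩ :=
    exists_split_cavI hp (fun p' q' => min (w p' q') (f p' q')) q hη
  have h1 := h.2.2 p hp q hq
  have h2 := hs.sum_le_sum fun m => min_le_left (w (ps m) q) (f (ps m) q)
  have h3 := hs.sum_le_sum fun m => min_le_right (w (ps m) q) (f (ps m) q)
  exact ⟨n, α, ps, hs, by linarith, by linarith⟩

lemma IsSolution.ge_of_memCminus (hA : ∀ a ∈ A, 0 ≤ a.2) (hAs : ∀ ε > 0, ∃ C, (ε, C) ∈ A)
    (hf : Good A rsK rsL f) (h : IsSolution A rsK rsL f w) {w' : (K → ℝ) → (L → ℝ) → ℝ}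
    (hw' : memCminus f w') {p : K → ℝ} {q : L → ℝ} (hp : p ∈ stdSimplex ℝ K)
    (hq : q ∈ stdSimplex ℝ L) : w' p q ≤ w p q := by
  refine le_of_forall_pos_le_add fun ε hε => ?_
  obtain ⟨η, hη, H⟩ := comparison hA hAs hf.modI hf.modII hε
  exact H w' w hw'.1.2 h.good.ranged (iConcave_negSwap_iff.2 hw'.2.1) h.concave
    (sub_of_memCminus hw' hη) (h.super η hη) p hp q hq

lemma MemC.negSwap (h : MemC w) : MemC (negSwap w) := by
  refine ⟨?_, Ranged.negSwap h.2⟩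
  have : ContinuousOn (fun x : (L → ℝ) × (K → ℝ) => w x.2 x.1)
      (stdSimplex ℝ L ×ˢ stdSimplex ℝ K) :=
    h.1.comp continuous_swap.continuousOn fun x hx => ⟨hx.2, hx.1⟩
  exact this.neg

lemma memCminus_negSwap_iff : memCminus (negSwap f) (negSwap w) ↔ memCplus f w := by
  have h1 : MemC (negSwap w) ↔ MemC w :=
    ⟨fun h => by simpa using MemC.negSwap h, MemC.negSwap⟩
  have h2 := iConcave_negSwap_iff (w := negSwap w)
  rw [negSwap_negSwap] at h2
  refine and_congr h1 (and_congr h2.symm ?_)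
  constructor
  · intro h p hp q hq
    rw [vexII_max_eq]
    have := h q hq p hp
    simp only [negSwap] at *
    linarith
  · intro h q hq p hp
    have := h p hp q hq
    rw [vexII_max_eq] at this
    simp only [negSwap] at *
    linarith

lemma exists_modulus (hf : MemC f) {ε : ℝ} (hε : 0 < ε) :
    ∃ C : ℝ, 0 ≤ C ∧ ∀ p ∈ stdSimplex ℝ K, ∀ p' ∈ stdSimplex ℝ K, ∀ q ∈ stdSimplex ℝ L,
      f p q - f p' q ≤ ε + C * dist1 p p' := by
  have hu := ((isCompact_stdSimplex ℝ K).prod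
    (isCompact_stdSimplex ℝ L)).uniformContinuousOn_of_continuous hf.1
  rw [Metric.uniformContinuousOn_iff] at hu
  obtain ⟨δ, hδ, H⟩ := hu ε hε
  refine ⟨2 / δ, by positivity, fun p hp p' hp' q hq => ?_⟩
  have hd0 : 0 ≤ dist1 p p' := Finset.sum_nonneg fun _ _ => abs_nonneg _
  have hd : dist p p' ≤ dist1 p p' := (dist_pi_le_iff hd0).2 fun k => by
    rw [Real.dist_eq]
    exact Finset.single_le_sum (f := fun k => |p k - p' k|) (fun _ _ => abs_nonneg _)
      (Finset.mem_univ k)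
  rcases lt_or_ge (dist1 p p') δ with h | h
  · have := H (p, q) ⟨hp, hq⟩ (p', q) ⟨hp', hq⟩ (by
      rw [Prod.dist_eq, dist_self, max_lt_iff]; exact ⟨hd.trans_lt h, hδ⟩)
    rw [Real.dist_eq] at this
    have h1 := (abs_lt.1 this).2
    have h2 : 0 ≤ 2 / δ * dist1 p p' := by positivity
    dsimp only at h1
    linarith
  · have h1 : 2 ≤ 2 / δ * dist1 p p' := by
      rw [div_mul_eq_mul_div, le_div_iff₀ hδ]; linarith
    linarith [(hf.2 p hp q hq).2, (hf.2 p' hp' q hq).1]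

lemma exists_good (hf : MemC f) (hb : BalancedFn rsK rsL f) :
    ∃ A : Set (ℝ × ℝ), (∀ a ∈ A, 0 ≤ a.2) ∧ (∀ ε > 0, ∃ C, (ε, C) ∈ A) ∧
      Good A rsK rsL f := by
  refine ⟨{a | 0 ≤ a.2 ∧ ModI {a} f ∧ ModI {a} (negSwap f)}, fun a ha => ha.1, fun ε hε => ?_,
    ⟨hf.2, fun a ha => ha.2.1 a rfl, fun a ha => ha.2.2 a rfl, hb⟩⟩
  obtain ⟨C₁, h₁, H₁⟩ := exists_modulus hf hε
  obtain ⟨C₂, h₂, H₂⟩ := exists_modulus (MemC.negSwap hf) hε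
  refine ⟨max C₁ C₂, h₁.trans (le_max_left _ _), ?_, ?_⟩
  · rintro _ rfl p hp p' hp' q hq
    have hd0 : 0 ≤ dist1 p p' := Finset.sum_nonneg fun _ _ => abs_nonneg _
    have := mul_le_mul_of_nonneg_right (le_max_left C₁ C₂) hd0
    exact (H₁ p hp p' hp' q hq).trans (by dsimp only; linarith)
  · rintro _ rfl p hp p' hp' q hq
    have hd0 : 0 ≤ dist1 p p' := Finset.sum_nonneg fun _ _ => abs_nonneg _
    have := mul_le_mul_of_nonneg_right (le_max_right C₁ C₂) hd0
    exact (H₂ p hp p' hp' q hq).trans (by dsimp only; linarith)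

lemma cavI_min_eq (hc : IConcave w) (h : memCminus f w)
    {p : K → ℝ} {q : L → ℝ} (hp : p ∈ stdSimplex ℝ K) (hq : q ∈ stdSimplex ℝ L) :
    w p q = cavI (fun p' q' => min (w p' q') (f p' q')) p q :=
  le_antisymm (h.2.2 p hp q hq) (cavI_le hp fun _ _ _ hs =>
    (hs.sum_le_sum fun _ => min_le_left _ _).trans (hc.sum_le hs hq))

/-- A balanced function which is simultaneously the greatest element of `𝒞⁻(f)`, the least element
of `𝒞⁺(f)`, and a solution of the Mertens–Zamir system. -/
lemma exists_MZ_solution (hf : MemC f) (hb : BalancedFn rsK rsL f) :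
    ∃ w, BalancedFn rsK rsL w ∧ memCminus f w ∧ memCplus f w ∧
      (∀ w', memCminus f w' → ∀ p ∈ stdSimplex ℝ K, ∀ q ∈ stdSimplex ℝ L, w' p q ≤ w p q) ∧
      (∀ w', memCplus f w' → ∀ p ∈ stdSimplex ℝ K, ∀ q ∈ stdSimplex ℝ L, w p q ≤ w' p q) ∧
      ∀ p ∈ stdSimplex ℝ K, ∀ q ∈ stdSimplex ℝ L,
        w p q = vexII (fun p' q' => max (w p' q') (f p' q')) p q ∧
        w p q = cavI (fun p' q' => min (w p' q') (f p' q')) p q := by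
  obtain ⟨A, hA, hAs, hg⟩ := exists_good hf hb
  obtain ⟨w, hw⟩ := exists_isSolution hA hAs hg
  have hm := hw.mem_Cminus hA hAs hg
  have hm' := hw.negSwap.mem_Cminus hA hAs hg.negSwap
  refine ⟨w, hw.good.balanced, hm, memCminus_negSwap_iff.1 hm',
    fun w' h' p hp q hq => hw.ge_of_memCminus hA hAs hg h' hp hq, fun w' h' p hp q hq => ?_,
    fun p hp q hq => ⟨?_, cavI_min_eq hw.concave hm hp hq⟩⟩
  · exact neg_le_neg_iff.1
      (hw.negSwap.ge_of_memCminus hA hAs hg.negSwap (memCminus_negSwap_iff.2 h') hq hp)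
  · rw [vexII_max_eq, ← cavI_min_eq hw.convex hm' hq hp]
    simp [negSwap]

end Solution

end MertensZamir

/-- **Proposition `comparison`.** For a balanced continuous `f : Δ(K)×Δ(L) → [-1,1]`,
the pointwise infimum `v̲` of the balanced elements of `𝒞⁺(f)` coincides with the
pointwise supremum `v̄` of the balanced elements of `𝒞⁻(f)`, and this common function
solves the Mertens–Zamir system associated with `f`. -/
theorem balanced_MZ_comparison {K L : Type*} [Fintype K] [Fintype L] {RK RL : ℕ}
    (rsK : RecStruct K RK) (rsL : RecStruct L RL)
    (f : (K → ℝ) → (L → ℝ) → ℝ) (hf : MemC f) (hbal : BalancedFn rsK rsL f) :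
    (∀ p ∈ stdSimplex ℝ K, ∀ q ∈ stdSimplex ℝ L,
      sInf {y : ℝ | ∃ w : (K → ℝ) → (L → ℝ) → ℝ,
          memCplus f w ∧ BalancedFn rsK rsL w ∧ y = w p q}
        = sSup {y : ℝ | ∃ w : (K → ℝ) → (L → ℝ) → ℝ,
          memCminus f w ∧ BalancedFn rsK rsL w ∧ y = w p q}) ∧
    (∀ p ∈ stdSimplex ℝ K, ∀ q ∈ stdSimplex ℝ L,
      (fun p' q' => sSup {y : ℝ | ∃ w : (K → ℝ) → (L → ℝ) → ℝ,
          memCminus f w ∧ BalancedFn rsK rsL w ∧ y = w p' q'}) p q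
        = vexII (fun p' q' =>
            max (sSup {y : ℝ | ∃ w : (K → ℝ) → (L → ℝ) → ℝ,
              memCminus f w ∧ BalancedFn rsK rsL w ∧ y = w p' q'}) (f p' q')) p q) ∧
    (∀ p ∈ stdSimplex ℝ K, ∀ q ∈ stdSimplex ℝ L,
      (fun p' q' => sSup {y : ℝ | ∃ w : (K → ℝ) → (L → ℝ) → ℝ,
          memCminus f w ∧ BalancedFn rsK rsL w ∧ y = w p' q'}) p q
        = cavI (fun p' q' =>
            min (sSup {y : ℝ | ∃ w : (K → ℝ) → (L → ℝ) → ℝ,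
              memCminus f w ∧ BalancedFn rsK rsL w ∧ y = w p' q'}) (f p' q')) p q) := by
  obtain ⟨w, hb, hm, hp, hle, hge, hsol⟩ := MertensZamir.exists_MZ_solution hf hbal
  have hsup : ∀ p ∈ stdSimplex ℝ K, ∀ q ∈ stdSimplex ℝ L,
      sSup {y : ℝ | ∃ w : (K → ℝ) → (L → ℝ) → ℝ,
        memCminus f w ∧ BalancedFn rsK rsL w ∧ y = w p q} = w p q := by
    intro p hp q hq
    refine IsGreatest.csSup_eq ⟨⟨w, hm, hb, rfl⟩, ?_⟩
    rintro _ ⟨w', h', -, rfl⟩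
    exact hle w' h' p hp q hq
  refine ⟨fun p hp' q hq => ?_, fun p hp' q hq => ?_, fun p hp' q hq => ?_⟩
  · rw [hsup p hp' q hq]
    refine IsLeast.csInf_eq ⟨⟨w, hp, hb, rfl⟩, ?_⟩
    rintro _ ⟨w', h', -, rfl⟩
    exact hge w' h' p hp' q hq
  · dsimp only
    rw [hsup p hp' q hq, MertensZamir.vexII_eq]
    refine (hsol p hp' q hq).1.trans ?_
    rw [MertensZamir.vexII_eq]
    refine congrArg Neg.neg (MertensZamir.cavI_congr (fun q' hq' => ?_) q)
    simp only [MertensZamir.negSwap, hsup p hp' q' hq']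
  · dsimp only
    rw [hsup p hp' q hq]
    refine (hsol p hp' q hq).2.trans (MertensZamir.cavI_congr (fun p' hp'' => ?_) p)
    simp only [hsup p' hp'' q hq]
end

section
/- For every recurrence structure on a finite set K and all p, p' ∈ Δ(K): ‖p − p'‖ ≤ S(p,p') ≤ 3‖p − p'‖. -/
namespace RecStruct

variable {K : Type*} [Fintype K] {R : ℕ}

theorem sum_lam (rs : RecStruct K R) (f : K → ℝ) : ∑ r, rs.lam f r = ∑ k, f k := by
  simp only [lam]
  rw [Finset.sum_comm]
  simp

theorem lam_nonneg (rs : RecStruct K R) {f : K → ℝ} (hf : ∀ k, 0 ≤ f k) (r : Fin R) :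
    0 ≤ rs.lam f r :=
  Finset.sum_nonneg fun k _ => by split_ifs <;> simp [hf k]

theorem abs_lam_sub_le (rs : RecStruct K R) (p p' : K → ℝ) (r : Fin R) :
    |rs.lam p r - rs.lam p' r| ≤ rs.lam (fun k => |p k - p' k|) r := by
  simp only [lam, ← Finset.sum_sub_distrib]
  refine (Finset.abs_sum_le_sum_abs _ _).trans (Finset.sum_le_sum fun k _ => ?_)
  split_ifs <;> simp

/-- If one of `p`, `p'` gives no mass to the class `r`, their `L¹` distance on that class is
the difference of the masses. -/
theorem lam_abs_sub_eq_of_mul_eq_zero (rs : RecStruct K R) {p p' : K → ℝ}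
    (hp : ∀ k, 0 ≤ p k) (hp' : ∀ k, 0 ≤ p' k) {r : Fin R}
    (h : rs.lam p r * rs.lam p' r = 0) :
    rs.lam (fun k => |p k - p' k|) r = |rs.lam p r - rs.lam p' r| := by
  have zero_on {f : K → ℝ} (hf : ∀ k, 0 ≤ f k) (h0 : rs.lam f r = 0) (k : K)
      (hk : rs.cls k = r) : f k = 0 := by
    have := (Finset.sum_eq_zero_iff_of_nonneg
      (fun k _ => by split_ifs <;> simp [hf k])).1 h0 k (Finset.mem_univ k)
    simpa [hk] using this
  rcases mul_eq_zero.1 h with h0 | h0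
  · rw [h0, zero_sub, abs_neg, abs_of_nonneg (rs.lam_nonneg hp' r)]
    refine Finset.sum_congr rfl fun k _ => ?_
    split_ifs with hk
    · simp [zero_on hp h0 k hk, abs_of_nonneg (hp' k)]
    · rfl
  · rw [h0, sub_zero, abs_of_nonneg (rs.lam_nonneg hp r)]
    refine Finset.sum_congr rfl fun k _ => ?_
    split_ifs with hk
    · simp [zero_on hp' h0 k hk, abs_of_nonneg (hp k)]
    · rfl

theorem abs_mul_abs_div_sub_div_sub_le {a b x : ℝ} (ha : 0 < a) (hb : 0 < b) (hx : 0 ≤ x)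
    (y : ℝ) : |b * |x / a - y / b| - (|x - y|)| ≤ x * (|a - b| / a) := by
  have h1 : b * |x / a - y / b| = |b * (x / a) - y| := by
    rw [← abs_of_pos hb, ← abs_mul, abs_of_pos hb, mul_sub, mul_div_cancel₀ _ hb.ne']
  have h2 : x * (|a - b| / a) = |b * (x / a) - y - (x - y)| := by
    rw [show b * (x / a) - y - (x - y) = -(x / a * (a - b)) by field_simp; ring, abs_neg,
      abs_mul, abs_of_nonneg (div_nonneg hx ha.le)]
    ring
  rw [h1, h2]
  exact abs_abs_sub_abs_le _ _

theorem abs_mul_dist1_cond_sub_le (rs : RecStruct K R) {p p' : K → ℝ} (hp : ∀ k, 0 ≤ p k)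
    {r : Fin R} (ha : 0 < rs.lam p r) (hb : 0 < rs.lam p' r) :
    |rs.lam p' r * dist1 (rs.cond p r) (rs.cond p' r) - rs.lam (fun k => |p k - p' k|) r| ≤
      |rs.lam p r - rs.lam p' r| := by
  have hsum : |rs.lam p r - rs.lam p' r| =
      ∑ k, (if rs.cls k = r then p k else 0) * (|rs.lam p r - rs.lam p' r| / rs.lam p r) := by
    rw [← Finset.sum_mul]
    exact (mul_div_cancel₀ _ ha.ne').symm
  rw [hsum, dist1, Finset.mul_sum]
  conv_lhs => enter [1, 2]; rw [lam]
  rw [← Finset.sum_sub_distrib]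
  refine (Finset.abs_sum_le_sum_abs _ _).trans (Finset.sum_le_sum fun k _ => ?_)
  simp only [cond, ha, hb, if_true]
  split_ifs
  · exact abs_mul_abs_div_sub_div_sub_le ha hb (hp k) _
  · simp

end RecStruct

/-- **Lemma `propertiesS`, part 1.** For every recurrence structure on a finite set `K`
and all `p, p' ∈ Δ(K)`: `‖p - p'‖₁ ≤ S(p,p') ≤ 3 ‖p - p'‖₁`. -/
theorem Sdist_between_dist1_and_three_dist1 {K : Type*} [Fintype K] {R : ℕ}
    (rs : RecStruct K R) (p p' : K → ℝ)
    (hp : p ∈ stdSimplex ℝ K) (hp' : p' ∈ stdSimplex ℝ K) :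
    dist1 p p' ≤ rs.Sdist p p' ∧ rs.Sdist p p' ≤ 3 * dist1 p p' := by
  have hsum : dist1 p p' = ∑ r, rs.lam (fun k => |p k - p' k|) r := (rs.sum_lam _).symm
  rw [hsum, RecStruct.Sdist, dist1, ← Finset.sum_add_distrib, Finset.mul_sum]
  have key (r : Fin R) : |(if 0 < rs.lam p r * rs.lam p' r
      then rs.lam p' r * dist1 (rs.cond p r) (rs.cond p' r) else 0) -
        rs.lam (fun k => |p k - p' k|) r| ≤ |rs.lam p r - rs.lam p' r| := by
    have ha := rs.lam_nonneg hp.1 r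
    have hb := rs.lam_nonneg hp'.1 r
    split_ifs with h
    · exact rs.abs_mul_dist1_cond_sub_le hp.1 (pos_of_mul_pos_left h hb)
        (pos_of_mul_pos_right h ha)
    · rw [rs.lam_abs_sub_eq_of_mul_eq_zero hp.1 hp'.1
        (le_antisymm (not_lt.1 h) (mul_nonneg ha hb))]
      simp
  constructor <;> refine Finset.sum_le_sum fun r _ => ?_
  · linarith [(abs_le.1 (key r)).1]
  · linarith [(abs_le.1 (key r)).2, rs.abs_lam_sub_le p p' r]
end

section
/- Let K be a finite set and let p = Σ_{s∈S} λ_s p_s be a finite convex combination in Δ(K) (S a finite set, λ_s ≥ 0 with Σ_{s∈S} λ_s = 1, and p_s ∈ Δ(K)). Then for every p' ∈ Δ(K) there exists a family (p'_s)_{s∈S} in Δ(K)^S such that p' = Σ_{s∈S} λ_s p'_s and Σ_{s∈S} λ_s ‖p_s − p'_s‖ = ‖p − p'‖. -/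
/-- If for every coordinate the differences `ps s k - ps' s k` have a sign independent of `s`,
then the weighted `L¹` distances add up to the distance between the barycenters. -/
theorem sum_mul_dist1_eq_of_sign {K S : Type*} [Fintype K] [Fintype S]
    (lam : S → ℝ) (ps ps' : S → K → ℝ) (hlam : ∀ s, 0 ≤ lam s)
    (hsign : ∀ k, (∀ s, ps s k ≤ ps' s k) ∨ (∀ s, ps' s k ≤ ps s k)) :
    ∑ s, lam s * dist1 (ps s) (ps' s) = dist1 (∑ s, lam s • ps s) (∑ s, lam s • ps' s) := by
  simp only [dist1, Finset.mul_sum]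
  rw [Finset.sum_comm]
  refine Finset.sum_congr rfl fun k _ => ?_
  simp only [Finset.sum_apply, Pi.smul_apply, smul_eq_mul, ← Finset.sum_sub_distrib, ← mul_sub]
  rcases hsign k with h | h
  · rw [abs_of_nonpos (Finset.sum_nonpos fun s _ =>
      mul_nonpos_of_nonneg_of_nonpos (hlam s) (sub_nonpos.2 (h s))), ← Finset.sum_neg_distrib]
    refine Finset.sum_congr rfl fun s _ => ?_
    rw [abs_of_nonpos (sub_nonpos.2 (h s)), mul_neg]
  · rw [abs_of_nonneg (Finset.sum_nonneg fun s _ => mul_nonneg (hlam s) (sub_nonneg.2 (h s)))]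
    refine Finset.sum_congr rfl fun s _ => ?_
    rw [abs_of_nonneg (sub_nonneg.2 (h s))]

/-- A nonnegative real decomposes relative to another one as a rescaling plus an excess. -/
theorem exists_scale_add_excess {a b : ℝ} (ha : 0 ≤ a) (hb : 0 ≤ b) :
    ∃ r e : ℝ, 0 ≤ r ∧ r ≤ 1 ∧ 0 ≤ e ∧ a * r + e = b ∧ (r = 1 ∨ e = 0) := by
  rcases le_or_gt a b with h | h
  · exact ⟨1, b - a, zero_le_one, le_rfl, sub_nonneg.2 h, by ring, Or.inl rfl⟩
  · have ha' : 0 < a := hb.trans_lt h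
    exact ⟨b / a, 0, div_nonneg hb ha, (div_le_one ha').2 h.le, le_rfl,
      by field_simp; ring, Or.inr rfl⟩

/-- **Laraki's splitting lemma (Lemma `lemRida`).** Let `p = ∑_s λ_s p_s` be a finite
convex combination in `Δ(K)`. Then for every `p' ∈ Δ(K)` there exists a family
`(p'_s)` in `Δ(K)` with `p' = ∑_s λ_s p'_s` and `∑_s λ_s ‖p_s - p'_s‖₁ = ‖p - p'‖₁`. -/
theorem laraki_splitting {K S : Type*} [Fintype K] [Fintype S]
    (lam : S → ℝ) (ps : S → K → ℝ)
    (hlam : ∀ s, 0 ≤ lam s) (hsum : ∑ s, lam s = 1)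
    (hps : ∀ s, ps s ∈ stdSimplex ℝ K)
    (p' : K → ℝ) (hp' : p' ∈ stdSimplex ℝ K) :
    ∃ ps' : S → K → ℝ, (∀ s, ps' s ∈ stdSimplex ℝ K) ∧
      (∑ s, lam s • ps' s) = p' ∧
      ∑ s, lam s * dist1 (ps s) (ps' s) = dist1 (∑ s, lam s • ps s) p' := by
  have hp : ∀ k, 0 ≤ ∑ s, lam s * ps s k := fun k =>
    Finset.sum_nonneg fun s _ => mul_nonneg (hlam s) ((hps s).1 k)
  choose r e hr0 hr1 he0 hre hcase using fun k => exists_scale_add_excess (hp k) (hp'.1 k)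
  have hdef : ∀ s, 0 ≤ 1 - ∑ k, ps s k * r k := fun s => by
    rw [← (hps s).2, ← Finset.sum_sub_distrib]
    exact Finset.sum_nonneg fun k _ =>
      sub_nonneg.2 (mul_le_of_le_one_right ((hps s).1 k) (hr1 k))
  have htotal : ∑ s, lam s * (1 - ∑ k, ps s k * r k) = ∑ k, e k := by
    have h1 : ∑ s, lam s * ∑ k, ps s k * r k = ∑ k, (∑ s, lam s * ps s k) * r k := by
      simp only [Finset.mul_sum, Finset.sum_mul]
      rw [Finset.sum_comm]
      simp only [mul_assoc]
    have h2 : ∑ k, (∑ s, lam s * ps s k) * r k + ∑ k, e k = 1 := by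
      rw [← Finset.sum_add_distrib, ← hp'.2]
      exact Finset.sum_congr rfl fun k _ => hre k
    simp only [mul_sub, mul_one, Finset.sum_sub_distrib]
    linarith
  rcases (Finset.sum_nonneg fun k _ => he0 k : 0 ≤ ∑ k, e k).eq_or_lt with hD | hD
  · have he : ∀ k, e k = 0 := fun k =>
      (Finset.sum_eq_zero_iff_of_nonneg fun k _ => he0 k).1 hD.symm k (Finset.mem_univ k)
    have hle : ∀ k, p' k ≤ ∑ s, lam s * ps s k := fun k => by
      rw [← hre k, he k, add_zero]
      exact mul_le_of_le_one_right (hp k) (hr1 k)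
    have hsum_eq : ∑ k, p' k = ∑ k, ∑ s, lam s * ps s k := by
      rw [hp'.2, Finset.sum_comm]
      simp only [← Finset.mul_sum, (hps _).2, mul_one, hsum]
    have heq : ∑ s, lam s • ps s = p' := by
      funext k
      simpa using ((Finset.sum_eq_sum_iff_of_le fun k _ => hle k).1 hsum_eq k
        (Finset.mem_univ k)).symm
    exact ⟨ps, hps, heq, by rw [heq]; simp [dist1, ← heq]⟩
  · have hbary : (∑ s, lam s • fun k =>
        ps s k * r k + (1 - ∑ j, ps s j * r j) * (e k / ∑ j, e j)) = p' := by
      funext k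
      simp only [Finset.sum_apply, Pi.smul_apply, smul_eq_mul, mul_add, Finset.sum_add_distrib,
        ← mul_assoc, ← Finset.sum_mul]
      rw [htotal, mul_div_cancel₀ _ hD.ne', hre k]
    refine ⟨_, fun s => ⟨fun k => ?_, ?_⟩, hbary, ?_⟩
    · exact add_nonneg (mul_nonneg ((hps s).1 k) (hr0 k))
        (mul_nonneg (hdef s) (div_nonneg (he0 k) hD.le))
    · rw [Finset.sum_add_distrib, ← Finset.mul_sum, ← Finset.sum_div, div_self hD.ne']
      ring
    · rw [sum_mul_dist1_eq_of_sign lam ps _ hlam fun k => ?_, hbary]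
      rcases hcase k with h | h
      · left
        intro s
        rw [h, mul_one]
        exact le_add_of_nonneg_right (mul_nonneg (hdef s) (div_nonneg (he0 k) hD.le))
      · right
        intro s
        rw [h, zero_div, mul_zero, add_zero]
        exact mul_le_of_le_one_right ((hps s).1 k) (hr1 k)
end

section
/- Let K and I be finite sets and z ∈ Δ(K×I); write z(i) = Σ_{k∈K} z(k,i) and, when z(i) > 0, p⃗(z,i) = (z(k,i)/z(i))_{k∈K} ∈ Δ(K). Let u_1,…,u_N and v_1,…,v_M be points of Δ(K), let β ∈ Δ({1,…,N}) and β' ∈ Δ({1,…,M}), and suppose there exist vectors F(i) ∈ Δ({1,…,N}) for each i with z(i) > 0 such that Σ_{n} F(i)(n) u_n = p⃗(z,i) for every such i, and Σ_{i : z(i)>0} z(i) F(i)(n) = β_n for every n (i.e. the disintegration of z is dominated by the measure Σ_n β_n δ_{u_n} in the convex order). Let π(n,m) ≥ 0 be a coupling of β and β', i.e. Σ_m π(n,m) = β_n and Σ_n π(n,m) = β'_m. Then there exist z' ∈ Δ(K×I) and, for each i with z(i) > 0, vectors p⃗'(i) ∈ Δ(K) and F'(i) ∈ Δ({1,…,M}),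 such that: z'(k,i) = z(i) · p⃗'(i)^k for all k and all i with z(i) > 0 (and z'(k,i) = 0 when z(i) = 0), Σ_m F'(i)(m) v_m = p⃗'(i) for each i, Σ_{i : z(i)>0} z(i) F'(i)(m) = β'_m for every m, and ‖z − z'‖ = Σ_{i : z(i)>0} z(i) ‖p⃗(z,i) − p⃗'(i)‖ ≤ Σ_{n,m} π(n,m) ‖u_n − v_m‖. -/
/-- **Nonexpansiveness of the set-valued map `R` (claim in Proposition 17).**
Let `z ∈ Δ(K×I)` with disintegration dominated (in the convex order, via the martingale
decomposition `F`) by `μ = ∑_n β_n δ_{u_n}`, and let `π` be a coupling of `β` with `β'`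
(the weights of `ν = ∑_m β'_m δ_{v_m}`). Then there are `z' ∈ Δ(K×I)`, posteriors
`p⃗'(i)` and a martingale decomposition `F'` witnessing that the disintegration of `z'`
is dominated by `ν`, with
`‖z - z'‖₁ = ∑_{i : z(i)>0} z(i) ‖p⃗(z,i) - p⃗'(i)‖₁ ≤ ∑_{n,m} π(n,m) ‖u_n - v_m‖₁`. -/
theorem R_nonexpansive {K I : Type*} [Fintype K] [Fintype I]
    (z : K × I → ℝ) (hz : z ∈ stdSimplex ℝ (K × I))
    {N M : ℕ} (u : Fin N → K → ℝ) (v : Fin M → K → ℝ)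
    (hu : ∀ n, u n ∈ stdSimplex ℝ K) (hv : ∀ m, v m ∈ stdSimplex ℝ K)
    (β : Fin N → ℝ) (β' : Fin M → ℝ)
    (hβ : β ∈ stdSimplex ℝ (Fin N)) (hβ' : β' ∈ stdSimplex ℝ (Fin M))
    (F : I → Fin N → ℝ)
    (hF_mem : ∀ i, 0 < (∑ k, z (k, i)) → F i ∈ stdSimplex ℝ (Fin N))
    (hF_bary : ∀ i, 0 < (∑ k, z (k, i)) →
      ∀ k, (∑ n, F i n * u n k) = z (k, i) / (∑ k', z (k', i)))
    (hF_marg : ∀ n, (∑ i, (∑ k, z (k, i)) * F i n) = β n)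
    (π : Fin N → Fin M → ℝ) (hπ0 : ∀ n m, 0 ≤ π n m)
    (hπ1 : ∀ n, ∑ m, π n m = β n) (hπ2 : ∀ m, ∑ n, π n m = β' m) :
    ∃ (z' : K × I → ℝ) (p' : I → K → ℝ) (F' : I → Fin M → ℝ),
      z' ∈ stdSimplex ℝ (K × I) ∧
      (∀ i, 0 < (∑ k, z (k, i)) →
        p' i ∈ stdSimplex ℝ K ∧ F' i ∈ stdSimplex ℝ (Fin M) ∧
        (∀ k, z' (k, i) = (∑ k', z (k', i)) * p' i k) ∧
        (∀ k, (∑ m, F' i m * v m k) = p' i k)) ∧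
      (∀ i, ¬ 0 < (∑ k, z (k, i)) → ∀ k, z' (k, i) = 0) ∧
      (∀ m, (∑ i, (∑ k, z (k, i)) * F' i m) = β' m) ∧
      dist1 z z' = (∑ i, (∑ k, z (k, i)) *
        dist1 (fun k => z (k, i) / (∑ k', z (k', i))) (p' i)) ∧
      dist1 z z' ≤ ∑ n, ∑ m, π n m * dist1 (u n) (v m) := by
  obtain ⟨hz0, hz1⟩ := hz
  set w : I → ℝ := fun i => ∑ k, z (k, i)
  have hw0 : ∀ i, 0 ≤ w i := fun i => Finset.sum_nonneg fun k _ => hz0 _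
  have hw1 : ∑ i, w i = 1 := by
    rw [← hz1, Fintype.sum_prod_type_right]
  have hβ0 : ∀ n, 0 ≤ β n := hβ.1
  have ha0 : ∀ i n, 0 ≤ w i * F i n := by
    intro i n
    rcases (hw0 i).eq_or_lt with h | h
    · simp [← h]
    · exact mul_nonneg h.le ((hF_mem i h).1 n)
  have ha_zero : ∀ i n, β n = 0 → w i * F i n = 0 := by
    intro i n h
    have hs : ∑ j, w j * F j n = 0 := (hF_marg n).trans h
    exact (Finset.sum_eq_zero_iff_of_nonneg fun j _ => ha0 j n).1 hs i (Finset.mem_univ i)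
  have hq0 : ∀ n m, 0 ≤ π n m / β n := fun n m => div_nonneg (hπ0 n m) (hβ0 n)
  have hq1 : ∀ n, β n ≠ 0 → ∑ m, π n m / β n = 1 := by
    intro n h
    rw [← Finset.sum_div, hπ1, div_self h]
  have hβq : ∀ n m, β n * (π n m / β n) = π n m := by
    intro n m
    by_cases h : β n = 0
    · have hs := (hπ1 n).trans h
      rw [(Finset.sum_eq_zero_iff_of_nonneg fun m _ => hπ0 n m).1 hs m (Finset.mem_univ m)]
      simp
    · field_simp
  have haq : ∀ i n, w i * F i n * ∑ m, π n m / β n = w i * F i n := by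
    intro i n
    by_cases h : β n = 0
    · rw [ha_zero i n h, zero_mul]
    · rw [hq1 n h, mul_one]
  let F' : I → Fin M → ℝ := fun i m => ∑ n, F i n * (π n m / β n)
  let p' : I → K → ℝ := fun i k => ∑ m, F' i m * v m k
  have hF' : ∀ i, 0 < w i → F' i ∈ stdSimplex ℝ (Fin M) := by
    intro i hi
    refine ⟨fun m => Finset.sum_nonneg fun n _ => mul_nonneg ((hF_mem i hi).1 n) (hq0 n m), ?_⟩
    rw [Finset.sum_comm, ← (hF_mem i hi).2]
    refine Finset.sum_congr rfl fun n _ => ?_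
    rw [← Finset.mul_sum]
    have := haq i n
    rw [mul_assoc] at this
    exact mul_left_cancel₀ hi.ne' this
  have hp' : ∀ i, 0 < w i → p' i ∈ stdSimplex ℝ K := by
    intro i hi
    refine ⟨fun k => Finset.sum_nonneg fun m _ => mul_nonneg ((hF' i hi).1 m) ((hv m).1 k), ?_⟩
    rw [Finset.sum_comm, ← (hF' i hi).2]
    refine Finset.sum_congr rfl fun m _ => ?_
    rw [← Finset.mul_sum, (hv m).2, mul_one]
  have hwp0 : ∀ i k, 0 ≤ w i * p' i k := by
    intro i k
    rcases (hw0 i).eq_or_lt with h | h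
    · simp [← h]
    · exact mul_nonneg h.le ((hp' i h).1 k)
  have hz_zero : ∀ i, w i = 0 → ∀ k, z (k, i) = 0 := fun i h k =>
    (Finset.sum_eq_zero_iff_of_nonneg fun k _ => hz0 (k, i)).1 h k (Finset.mem_univ k)
  have hz_eq : ∀ i k, z (k, i) = ∑ n, ∑ m, w i * F i n * (π n m / β n) * u n k := by
    intro i k
    simp_rw [← Finset.sum_mul, ← Finset.mul_sum, haq]
    rcases (hw0 i).eq_or_lt with h | h
    · simp [← h, hz_zero i h.symm k]
    · simp_rw [mul_assoc, ← Finset.mul_sum]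
      rw [hF_bary i h k, mul_div_cancel₀ _ h.ne']
  have hz'_eq : ∀ i k, w i * p' i k = ∑ n, ∑ m, w i * F i n * (π n m / β n) * v m k := by
    intro i k
    rw [Finset.sum_comm]
    simp only [p', F', Finset.mul_sum, Finset.sum_mul, mul_assoc]
  refine ⟨fun x => w x.2 * p' x.2 x.1, p', F', ⟨fun x => hwp0 x.2 x.1, ?_⟩, ?_, ?_, ?_, ?_, ?_⟩
  · rw [Fintype.sum_prod_type_right, ← hw1]
    refine Finset.sum_congr rfl fun i _ => ?_
    change ∑ k, w i * p' i k = w i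
    rw [← Finset.mul_sum]
    rcases (hw0 i).eq_or_lt with h | h
    · simp [← h]
    · rw [(hp' i h).2, mul_one]
  · exact fun i hi => ⟨hp' i hi, hF' i hi, fun k => rfl, fun k => rfl⟩
  · intro i hi k
    have h : w i = 0 := le_antisymm (not_lt.1 hi) (hw0 i)
    simp [h]
  · intro m
    simp only [F', Finset.mul_sum]
    rw [Finset.sum_comm, ← hπ2 m]
    refine Finset.sum_congr rfl fun n _ => ?_
    simp_rw [← mul_assoc]
    rw [← Finset.sum_mul, hF_marg n, hβq n m]
  · simp only [dist1]
    rw [Fintype.sum_prod_type_right]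
    refine Finset.sum_congr rfl fun i _ => ?_
    rw [Finset.mul_sum]
    refine Finset.sum_congr rfl fun k _ => ?_
    rcases (hw0 i).eq_or_lt with h | h
    · change |z (k, i) - w i * p' i k| = w i * _
      simp [← h, hz_zero i h.symm k]
    · change |z (k, i) - w i * p' i k| = w i * |z (k, i) / w i - p' i k|
      rw [← abs_of_pos h, ← abs_mul, abs_of_pos h, mul_sub, mul_div_cancel₀ _ h.ne']
  · have hbound : ∀ i k, |z (k, i) - w i * p' i k| ≤
        ∑ n, ∑ m, w i * F i n * (π n m / β n) * |u n k - v m k| := by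
      intro i k
      rw [hz_eq, hz'_eq]
      simp_rw [← Finset.sum_sub_distrib, ← mul_sub]
      refine (Finset.abs_sum_le_sum_abs _ _).trans (Finset.sum_le_sum fun n _ => ?_)
      refine (Finset.abs_sum_le_sum_abs _ _).trans (Finset.sum_le_sum fun m _ => ?_)
      rw [abs_mul, abs_of_nonneg (mul_nonneg (ha0 i n) (hq0 n m))]
    calc dist1 z (fun x => w x.2 * p' x.2 x.1)
        = ∑ i, ∑ k, |z (k, i) - w i * p' i k| := by
          simp only [dist1, Fintype.sum_prod_type_right]
      _ ≤ ∑ i, ∑ k, ∑ n, ∑ m, w i * F i n * (π n m / β n) * |u n k - v m k| :=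
          Finset.sum_le_sum fun i _ => Finset.sum_le_sum fun k _ => hbound i k
      _ = ∑ i, ∑ n, ∑ m, w i * F i n * (π n m / β n) * dist1 (u n) (v m) := by
          refine Finset.sum_congr rfl fun i _ => ?_
          rw [Finset.sum_comm]
          refine Finset.sum_congr rfl fun n _ => ?_
          rw [Finset.sum_comm]
          simp only [dist1, Finset.mul_sum]
      _ = ∑ n, ∑ m, π n m * dist1 (u n) (v m) := by
          rw [Finset.sum_comm]
          refine Finset.sum_congr rfl fun n _ => ?_
          rw [Finset.sum_comm]
          refine Finset.sum_congr rfl fun m _ => ?_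
          rw [← Finset.sum_mul, ← Finset.sum_mul, hF_marg n, hβq n m]
end

section
/- Let K and L be finite sets and let f, w : Δ(K)×Δ(L) → ℝ be continuous functions such that w(p,q) ≤ cav_I min(w,f)(p,q) for all (p,q) ∈ Δ(K)×Δ(L). Then for every (p,q) there exist α_1,…,α_{|K|} ≥ 0 with Σ_{m=1}^{|K|} α_m = 1 and p_1,…,p_{|K|} ∈ Δ(K) such that p = Σ_{m=1}^{|K|} α_m p_m, w(p_m,q) ≤ f(p_m,q) for every m = 1,…,|K|, and Σ_{m=1}^{|K|} α_m w(p_m,q) ≥ w(p,q). -/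
theorem sum_extend_smul {ι κ E : Type*} [Fintype ι] [Fintype κ] [AddCommMonoid E] [Module ℝ E]
    {e : ι → κ} {r : κ → ι} (hr : Function.LeftInverse r e) (a : ι → ℝ) (z : ι → E) :
    ∑ m, Function.extend e a 0 m • z (r m) = ∑ i, a i • z i := by
  refine (Fintype.sum_of_injective e hr.injective _ _ (fun m hm => ?_) fun i => ?_).symm
  · rw [Function.extend_apply' _ _ _ hm, Pi.zero_apply, zero_smul]
  · rw [hr.injective.extend_apply, hr i]

theorem extend_zero_nonneg {ι κ : Type*} {e : ι → κ} (he : Function.Injective e) {a : ι → ℝ}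
    (ha : ∀ i, 0 ≤ a i) (m : κ) : 0 ≤ Function.extend e a 0 m := by
  by_cases hm : ∃ i, e i = m
  · obtain ⟨i, rfl⟩ := hm
    rw [he.extend_apply]
    exact ha i
  · rw [Function.extend_apply' _ _ _ hm, Pi.zero_apply]

theorem exists_leftInverse_fin {ι : Type*} [Fintype ι] [Nonempty ι] {n : ℕ}
    (h : Fintype.card ι ≤ n) :
    ∃ (e : ι → Fin n) (r : Fin n → ι), Function.LeftInverse r e := by
  obtain ⟨e⟩ := Function.Embedding.nonempty_of_card_le (β := Fin n) (by simpa using h)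
  exact ⟨e, Function.invFun e, Function.leftInverse_invFun e.injective⟩

theorem nonempty_of_sum_eq_one {ι : Type*} [Fintype ι] {a : ι → ℝ} (h : ∑ i, a i = 1) :
    Nonempty ι := by
  by_contra hι
  rw [not_nonempty_iff] at hι
  simp at h

theorem isCompact_convexHull_of_finiteDimensional {E : Type*} [AddCommGroup E] [Module ℝ E]
    [TopologicalSpace E] [ContinuousAdd E] [ContinuousSMul ℝ E] [FiniteDimensional ℝ E]
    {s : Set E} (hs : IsCompact s) : IsCompact (convexHull ℝ s) := by
  let n := Module.finrank ℝ E + 1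
  let Φ : (Fin n → ℝ) × (Fin n → E) → E := fun wz => ∑ i, wz.1 i • wz.2 i
  have hΦ : Continuous Φ := by fun_prop
  have hc := ((isCompact_stdSimplex ℝ (Fin n)).prod
    (isCompact_univ_pi fun _ : Fin n => hs)).image hΦ
  convert hc using 1
  apply Set.Subset.antisymm
  · intro x hx
    obtain ⟨ι, _, z, a, hz, hind, ha, hsum, rfl⟩ := eq_pos_convex_span_of_mem_convexHull hx
    have := nonempty_of_sum_eq_one hsum
    have hcard : Fintype.card ι ≤ n := hind.card_le_finrank_succ.trans
      (Nat.succ_le_succ (Submodule.finrank_le _))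
    obtain ⟨e, r, hr⟩ := exists_leftInverse_fin hcard
    refine ⟨(Function.extend e a 0, z ∘ r),
      ⟨⟨extend_zero_nonneg hr.injective fun i => (ha i).le, ?_⟩,
        fun m _ => hz (Set.mem_range_self _)⟩, sum_extend_smul hr a z⟩
    simpa [hsum] using sum_extend_smul hr a fun _ => (1 : ℝ)
  · rintro _ ⟨⟨a, z⟩, ⟨⟨ha, hsum⟩, hz⟩, rfl⟩
    exact (convex_convexHull ℝ s).sum_mem (fun i _ => ha i) hsum
      fun i _ => subset_convexHull ℝ s (hz i trivial)

/-- The convex hull of the graph of `g` over the standard simplex. -/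
def graphHull {K : Type*} [Fintype K] (g : (K → ℝ) → ℝ) : Set ((K → ℝ) × ℝ) :=
  convexHull ℝ ((fun x => (x, g x)) '' stdSimplex ℝ K)

theorem exists_isGreatest_graphHull_slice {K : Type*} [Fintype K] {g : (K → ℝ) → ℝ}
    (hg : ContinuousOn g (stdSimplex ℝ K)) {p : K → ℝ} (hp : p ∈ stdSimplex ℝ K) :
    ∃ y, IsGreatest {y | (p, y) ∈ graphHull g} y := by
  have hc : IsCompact (graphHull g) :=
    isCompact_convexHull_of_finiteDimensional
      ((isCompact_stdSimplex ℝ K).image_of_continuousOn (continuousOn_id.prodMk hg))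
  have hslice : IsCompact (Prod.snd '' (graphHull g ∩ Prod.fst ⁻¹' {p})) :=
    (hc.inter_right (isClosed_singleton.preimage continuous_fst)).image continuous_snd
  have heq : Prod.snd '' (graphHull g ∩ Prod.fst ⁻¹' {p}) = {y | (p, y) ∈ graphHull g} := by
    ext y
    constructor
    · rintro ⟨⟨x, y⟩, ⟨hxy, rfl⟩, rfl⟩
      exact hxy
    · intro hy
      exact ⟨(p, y), ⟨hy, rfl⟩, rfl⟩
  rw [heq] at hslice
  exact hslice.exists_isGreatest ⟨g p, subset_convexHull ℝ _ ⟨p, hp, rfl⟩⟩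

theorem sum_mem_graphHull {K ι : Type*} [Fintype K] [Fintype ι] {g : (K → ℝ) → ℝ}
    {a y : ι → ℝ} {x : ι → K → ℝ} (ha : ∀ i, 0 ≤ a i) (hsum : ∑ i, a i = 1)
    (hxy : ∀ i, (x i, y i) ∈ graphHull g) :
    (∑ i, a i • x i, ∑ i, a i * y i) ∈ graphHull g := by
  have := (convex_convexHull ℝ ((fun x => (x, g x)) '' stdSimplex ℝ K)).sum_mem
    (t := Finset.univ) (fun i _ => ha i) hsum (fun i _ => hxy i)
  convert this using 1
  · rfl
  · exact Prod.ext (by simp [Prod.fst_sum]) (by simp [Prod.snd_sum])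

theorem mem_graphHull {K : Type*} [Fintype K] {g : (K → ℝ) → ℝ} {x : K → ℝ}
    (hx : x ∈ stdSimplex ℝ K) : (x, g x) ∈ graphHull g :=
  subset_convexHull ℝ _ ⟨x, hx, rfl⟩

/-- The maximal point of the graph hull above `p` is a convex combination with positive weights
of graph points whose base points are linearly independent. -/
theorem exists_linearIndependent_of_isGreatest {K : Type*} [Fintype K] {g : (K → ℝ) → ℝ}
    {p : K → ℝ} {y : ℝ} (hy : IsGreatest {y | (p, y) ∈ graphHull g} y) :
    ∃ (ι : Type) (_ : Fintype ι) (x : ι → K → ℝ) (a : ι → ℝ),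
      (∀ i, x i ∈ stdSimplex ℝ K) ∧ LinearIndependent ℝ x ∧ (∀ i, 0 < a i) ∧ ∑ i, a i = 1 ∧
      ∑ i, a i • x i = p ∧ ∑ i, a i * g (x i) = y := by
  obtain ⟨ι', _, z, a', hz, hind, ha', hsum', hz'⟩ := eq_pos_convex_span_of_mem_convexHull hy.1
  let e := (Fintype.equivFin ι').symm
  choose x' hx' hxz' using fun i => hz (Set.mem_range_self i)
  let x := x' ∘ e
  let a := a' ∘ e
  have hsum : ∑ i, a i = 1 := by rw [← hsum']; exact e.sum_comp a'
  have ha : ∀ i, 0 < a i := fun i => ha' _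
  have hx : ∀ i, x i ∈ stdSimplex ℝ K := fun i => hx' _
  have hind' : AffineIndependent ℝ (fun i => (x i, g (x i))) := by
    have : (fun i => (x i, g (x i))) = z ∘ e := funext fun i => hxz' _
    rw [this]
    exact hind.comp_embedding e.toEmbedding
  have hpt : ∑ i, a i • (x i, g (x i)) = (p, y) := by
    rw [← hz', ← e.sum_comp]
    exact Finset.sum_congr rfl fun i _ => congrArg (a i • ·) (hxz' _)
  have hp : ∑ i, a i • x i = p := by
    simpa [Prod.fst_sum] using congrArg Prod.fst hpt
  have hgy : ∑ i, a i * g (x i) = y := by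
    simpa [Prod.snd_sum] using congrArg Prod.snd hpt
  refine ⟨_, _, x, a, hx, ?_, ha, hsum, hp, hgy⟩
  rw [Fintype.linearIndependent_iff]
  intro c hc
  have hc0 : ∑ i, c i = 0 := by
    have : ∑ k, (∑ i, c i • x i) k = 0 := by rw [hc]; simp
    simp only [Finset.sum_apply, Pi.smul_apply, smul_eq_mul] at this
    rw [Finset.sum_comm] at this
    simpa [← Finset.mul_sum, (hx _).2] using this
  have hev : ∀ᶠ t : ℝ in nhds 0, ∀ i, 0 < a i + t * c i := by
    rw [Filter.eventually_all]
    intro i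
    have hcont : Continuous fun t : ℝ => a i + t * c i := by fun_prop
    exact hcont.continuousAt.eventually (lt_mem_nhds (by simpa using ha i))
  have hle : ∀ᶠ t : ℝ in nhds 0, t * ∑ i, c i * g (x i) ≤ 0 := by
    filter_upwards [hev] with t ht
    have hmem := sum_mem_graphHull (a := fun i => a i + t * c i) (fun i => (ht i).le)
      (by simp [Finset.sum_add_distrib, ← Finset.mul_sum, hsum, hc0])
      (fun i => mem_graphHull (g := g) (hx i))
    have h1 : ∑ i, (a i + t * c i) • x i = p := by
      simp only [add_smul, Finset.sum_add_distrib, hp, mul_smul, ← Finset.smul_sum, hc]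
      simp
    have h2 : ∑ i, (a i + t * c i) * g (x i) = y + t * ∑ i, c i * g (x i) := by
      simp only [add_mul, Finset.sum_add_distrib, hgy, mul_assoc, ← Finset.mul_sum]
    rw [h1, h2] at hmem
    linarith [hy.2 hmem]
  have hs : ∑ i, c i * g (x i) = 0 := by
    obtain ⟨δ, hδ, hb⟩ := Metric.eventually_nhds_iff.1 hle
    have h1 := @hb (δ / 2) (by rw [dist_zero_right, Real.norm_eq_abs, abs_of_pos] <;> linarith)
    have h2 := @hb (-(δ / 2)) (by
      rw [dist_zero_right, Real.norm_eq_abs, abs_neg, abs_of_pos] <;> linarith)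
    nlinarith
  intro i
  refine affineIndependent_iff.1 hind' Finset.univ c hc0 ?_ i (Finset.mem_univ i)
  ext k
  · simpa [Prod.fst_sum] using congrFun hc k
  · simpa [Prod.snd_sum] using hs

theorem cavI_le_of_isGreatest {K L : Type*} [Fintype K] {g : (K → ℝ) → (L → ℝ) → ℝ}
    {p : K → ℝ} {q : L → ℝ} (hp : p ∈ stdSimplex ℝ K) {y : ℝ}
    (hy : IsGreatest {y | (p, y) ∈ graphHull fun x => g x q} y) : cavI g p q ≤ y := by
  refine csSup_le ⟨g p q, 1, fun _ => 1, fun _ => p, ?_⟩ ?_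
  · simpa using hp
  · rintro _ ⟨n, α, ps, hα, hsum, hps, rfl, rfl⟩
    exact hy.2 (sum_mem_graphHull hα hsum fun m =>
      mem_graphHull (g := fun x => g x q) (hps m))

/-- **Splitting lemma (Lemma `splitting`).** If `w ≤ cav_I min(w,f)` on `Δ(K)×Δ(L)`,
then for every `(p,q)` there is a convex decomposition of `p` into `|K|` points `p_m`
with `w(p_m,q) ≤ f(p_m,q)` for all `m` and `∑_m α_m w(p_m,q) ≥ w(p,q)`. -/
theorem splitting_lemma {K L : Type*} [Fintype K] [Fintype L]
    (f w : (K → ℝ) → (L → ℝ) → ℝ)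
    (hf : ContinuousOn (fun pq : (K → ℝ) × (L → ℝ) => f pq.1 pq.2)
      (stdSimplex ℝ K ×ˢ stdSimplex ℝ L))
    (hw : ContinuousOn (fun pq : (K → ℝ) × (L → ℝ) => w pq.1 pq.2)
      (stdSimplex ℝ K ×ˢ stdSimplex ℝ L))
    (h : ∀ p ∈ stdSimplex ℝ K, ∀ q ∈ stdSimplex ℝ L,
      w p q ≤ cavI (fun p' q' => min (w p' q') (f p' q')) p q) :
    ∀ p ∈ stdSimplex ℝ K, ∀ q ∈ stdSimplex ℝ L,
      ∃ (α : Fin (Fintype.card K) → ℝ) (ps : Fin (Fintype.card K) → K → ℝ),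
        (∀ m, 0 ≤ α m) ∧ (∑ m, α m = 1) ∧
        (∀ m, ps m ∈ stdSimplex ℝ K) ∧
        (∑ m, α m • ps m = p) ∧
        (∀ m, w (ps m) q ≤ f (ps m) q) ∧
        w p q ≤ ∑ m, α m * w (ps m) q := by
  intro p hp q hq
  have hslice : ∀ u : (K → ℝ) → (L → ℝ) → ℝ,
      ContinuousOn (fun pq : (K → ℝ) × (L → ℝ) => u pq.1 pq.2)
        (stdSimplex ℝ K ×ˢ stdSimplex ℝ L) →
      ContinuousOn (fun x => u x q) (stdSimplex ℝ K) := fun u hu =>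
    hu.comp (f := fun x => (x, q)) (continuousOn_id.prodMk continuousOn_const)
      fun x hx => ⟨hx, hq⟩
  have hg : ContinuousOn (fun x => min (w x q) (f x q)) (stdSimplex ℝ K) :=
    ContinuousOn.inf (hslice w hw) (hslice f hf)
  obtain ⟨y, hy⟩ := exists_isGreatest_graphHull_slice hg hp
  obtain ⟨ι, _, x, a, hx, hind, ha, hsum, hxp, hxy⟩ := exists_linearIndependent_of_isGreatest hy
  have hwp : w p q ≤ y := (h p hp q hq).trans
    (cavI_le_of_isGreatest (g := fun p' q' => min (w p' q') (f p' q')) hp hy)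
  choose Y hY using fun i => exists_isGreatest_graphHull_slice hg (hx i)
  have hwY : ∀ i, w (x i) q ≤ Y i := fun i => (h _ (hx i) q hq).trans
    (cavI_le_of_isGreatest (g := fun p' q' => min (w p' q') (f p' q')) (hx i) (hY i))
  have hYy : ∑ i, a i * Y i ≤ y := by
    have hmem := sum_mem_graphHull (fun i => (ha i).le) hsum fun i => (hY i).1
    rw [hxp] at hmem
    exact hy.2 hmem
  have hwy : ∑ i, a i * w (x i) q ≤ y :=
    (Finset.sum_le_sum fun i _ => mul_le_mul_of_nonneg_left (hwY i) (ha i).le).trans hYy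
  have hterm : ∀ i ∈ Finset.univ, a i * min (w (x i) q) (f (x i) q) ≤ a i * w (x i) q :=
    fun i _ => mul_le_mul_of_nonneg_left (min_le_left _ _) (ha i).le
  have heq := (Finset.sum_eq_sum_iff_of_le hterm).1
    (le_antisymm (Finset.sum_le_sum hterm) (hwy.trans hxy.ge))
  have hwf : ∀ i, w (x i) q ≤ f (x i) q := fun i =>
    min_eq_left_iff.1 (mul_left_cancel₀ (ha i).ne' (heq i (Finset.mem_univ i)))
  have hyw : y ≤ ∑ i, a i * w (x i) q := hxy.ge.trans (Finset.sum_le_sum hterm)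
  have hcard : Fintype.card ι ≤ Fintype.card K := by
    simpa using hind.fintype_card_le_finrank
  have := nonempty_of_sum_eq_one hsum
  obtain ⟨e, r, hr⟩ := exists_leftInverse_fin hcard
  refine ⟨Function.extend e a 0, x ∘ r, extend_zero_nonneg hr.injective fun i => (ha i).le, ?_,
    fun m => hx _, (sum_extend_smul hr a x).trans hxp, fun m => hwf _,
    (hwp.trans hyw).trans_eq (sum_extend_smul hr a fun i => w (x i) q).symm⟩
  simpa [hsum] using sum_extend_smul hr a fun _ => (1 : ℝ)
end
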